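/- arXiv:2108.07334 — 2 statements merged into one kernel-verified Lean document; each statement's English description precedes it below -/
import Mathlib

section
/- Let 0 < ε < 1/2 and C > 0 be constants. There exist constants r₀, K and n₀, depending only on ε and C, such that the following holds for all n ≥ n₀. Let G be a finite abelian group, let A = {a₁, …, a_n} be a multiset of elements of G, let α satisfy 1/2 ≤ α ≤ 1, and let ξ be a lazy Bernoulli random variable of parameter α. If ρ_ξ(A) ≥ n^{−C}, then for every n' with α^{−1}·n^{ε} ≤ n' ≤ n there exists a proper symmetric coset-progression H + P in G of rank r ≤ r₀ such that 2a_i ∈ H + P for at least n − n' indices i ∈ {1, …, n} (counted with multiplicity), and |H + P| ≤ max{1, K · ρ_ξ(A)^{−1} / (n')^{r/2}}. -/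
open Pointwise

/-- A generalized arithmetic progression (GAP) of rank `r` in an additive abelian group,
given by its generators and dimensions. -/
structure GAPData (G : Type*) [AddCommGroup G] (r : ℕ) where
  g₀ : G
  g : Fin r → G
  N : Fin r → ℤ
  N' : Fin r → ℤ
  hle : ∀ i, N i ≤ N' i

namespace GAPData

variable {G : Type*} [AddCommGroup G] {r : ℕ}

/-- The set of elements of the GAP. -/
def toSet (P : GAPData G r) : Set G :=
  {x | ∃ m : Fin r → ℤ, (∀ i, P.N i ≤ m i ∧ m i ≤ P.N' i) ∧ x = P.g₀ + ∑ i, m i • P.g i}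

/-- A GAP is proper if every element has a unique representation. -/
def IsProper (P : GAPData G r) : Prop :=
  ∀ m m' : Fin r → ℤ, (∀ i, P.N i ≤ m i ∧ m i ≤ P.N' i) →
    (∀ i, P.N i ≤ m' i ∧ m' i ≤ P.N' i) →
    P.g₀ + ∑ i, m i • P.g i = P.g₀ + ∑ i, m' i • P.g i → m = m'

/-- A GAP is symmetric if `g₀ = 0` and `N i = -N' i` for all `i`. -/
def IsSymmetric (P : GAPData G r) : Prop :=
  P.g₀ = 0 ∧ ∀ i, P.N i = -P.N' i

end GAPData

/-- `H + P` is a proper coset-progression: `H` is a finite subgroup, `P` is a proper GAP and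
`|H + P| = |H| * |P|`. -/
def IsProperCosetProg {G : Type*} [AddCommGroup G] {r : ℕ}
    (H : AddSubgroup G) (P : GAPData G r) : Prop :=
  (H : Set G).Finite ∧ P.IsProper ∧
    ((H : Set G) + P.toSet).ncard = (H : Set G).ncard * P.toSet.ncard

/-- The probability that the random walk `∑ i, A i * x i`, with `x i` iid lazy Bernoulli
random variables of parameter `α` (taking value `0` with probability `1 - α` and `±1` with
probability `α/2` each), equals `a`. -/
noncomputable def lazyProb {G : Type*} [AddCommGroup G] [DecidableEq G] {n : ℕ}
    (A : Fin n → G) (α : ℝ) (a : G) : ℝ :=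
  ∑ x : Fin n → Fin 3, (∏ i, ![α / 2, 1 - α, α / 2] (x i)) *
    (if (∑ i, (![(-1 : ℤ), 0, 1] (x i)) • A i) = a then 1 else 0)

/-- The maximum discrepancy `ρ_ξ(A)` of the lazy Bernoulli random walk from the uniform
measure on `G`. -/
noncomputable def lazyRho {G : Type*} [AddCommGroup G] [Fintype G] [DecidableEq G] {n : ℕ}
    (A : Fin n → G) (α : ℝ) : ℝ :=
  ⨆ a : G, |lazyProb A α a - 1 / (Fintype.card G : ℝ)|

open Module in
/-- Reduced-basis theorem: the points of norm at most `R` of a discrete subgroup of a normed space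
of dimension at most `d` lie in a progression whose sides have length `O_d(R)`. -/
theorem exists_progression_of_discrete (d : ℕ) : ∃ C : ℝ, 1 ≤ C ∧
    ∀ (V : Type) [NormedAddCommGroup V] [NormedSpace ℝ V] [FiniteDimensional ℝ V],
      finrank ℝ V ≤ d → ∀ Γ : AddSubgroup V, (∀ ρ : ℝ, {x | x ∈ Γ ∧ ‖x‖ ≤ ρ}.Finite) →
      ∀ R : ℝ, 0 < R → ∃ r ≤ d, ∃ (v : Fin r → V) (N : Fin r → ℕ),
        (∀ i, v i ∈ Γ ∧ 1 ≤ N i ∧ N i * ‖v i‖ ≤ C * R) ∧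
        (∀ m : Fin r → ℤ, ∑ i, m i • v i = 0 → m = 0) ∧
        ∀ x ∈ Γ, ‖x‖ ≤ R → ∃ m : Fin r → ℤ, (∀ i, |m i| ≤ N i) ∧ x = ∑ i, m i • v i := by
  induction d with
  | zero =>
    refine ⟨1, le_rfl, ?_⟩
    intro V _ _ _ hV Γ _ R _
    have : Subsingleton V := finrank_zero_iff.1 (Nat.le_zero.1 hV)
    refine ⟨0, le_rfl, Fin.elim0, Fin.elim0, fun i => i.elim0, fun m _ => Subsingleton.elim _ _, ?_⟩
    intro x _ _
    exact ⟨Fin.elim0, fun i => i.elim0, Subsingleton.elim _ _⟩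
  | succ d ih =>
    obtain ⟨C, hC1, ih⟩ := ih
    refine ⟨1 + 4 * (d + 1) * C, by nlinarith [(Nat.cast_nonneg d : (0 : ℝ) ≤ d)], ?_⟩
    intro V _ _ _ hV Γ hΓ R hR
    by_cases hne : ∃ x ∈ Γ, ‖x‖ ≤ R ∧ x ≠ 0
    swap
    · push Not at hne
      refine ⟨0, Nat.zero_le _, Fin.elim0, Fin.elim0, fun i => i.elim0,
        fun m _ => Subsingleton.elim _ _, ?_⟩
      intro x hx hxR
      exact ⟨Fin.elim0, fun i => i.elim0, by simpa using hne x hx hxR⟩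
    obtain ⟨x₀, hx₀, hx₀R, hx₀0⟩ := hne
    have hfin : {x | (x ∈ Γ ∧ ‖x‖ ≤ R) ∧ x ≠ 0}.Finite := (hΓ R).subset fun x hx => hx.1
    obtain ⟨u, ⟨⟨huΓ, huR⟩, hu0⟩, humin'⟩ := Set.exists_min_image _ (fun x : V => ‖x‖) hfin
      ⟨x₀, ⟨hx₀, hx₀R⟩, hx₀0⟩
    have humin : ∀ x ∈ Γ, x ≠ 0 → ‖u‖ ≤ ‖x‖ := by
      intro x hx hx0
      by_cases h : ‖x‖ ≤ R
      · exact humin' x ⟨⟨hx, h⟩, hx0⟩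
      · exact huR.trans (le_of_not_ge h)
    have hupos : 0 < ‖u‖ := norm_pos_iff.2 hu0
    let L : Submodule ℝ V := Submodule.span ℝ {u}
    have : IsClosed (L : Set V) := Submodule.closed_of_finiteDimensional L
    let Q := V ⧸ L
    let π : V →ₗ[ℝ] Q := L.mkQ
    have hQ : finrank ℝ Q ≤ d := by
      have h1 := Submodule.finrank_quotient_add_finrank L
      have h2 : finrank ℝ L = 1 := finrank_span_singleton hu0
      change finrank ℝ (V ⧸ L) ≤ d
      omega
    let Γ' : AddSubgroup Q := Γ.map π.toAddMonoidHom
    have hlift : ∀ q ∈ Γ', ∃ x ∈ Γ, π x = q ∧ ‖x‖ ≤ ‖q‖ + 3 / 4 * ‖u‖ := by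
      rintro q ⟨x, hx, rfl⟩
      obtain ⟨y, hy, hyn⟩ := Submodule.Quotient.norm_mk_lt (S := L) (π x)
        (ε := ‖u‖ / 4) (by positivity)
      have hyx : y - x ∈ L := by
        rw [← Submodule.Quotient.eq]; exact hy
      obtain ⟨t, ht⟩ := Submodule.mem_span_singleton.1 hyx
      refine ⟨x + round t • u, Γ.add_mem hx (Γ.zsmul_mem huΓ _), ?_, ?_⟩
      · have hu : π u = 0 := (Submodule.Quotient.mk_eq_zero L).2 (Submodule.mem_span_singleton_self u)
        show π _ = π x
        rw [map_add, map_zsmul, hu]; simp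
      · have e : x + round t • u = y - (t - round t) • u := by
          rw [sub_smul, ht, Int.cast_smul_eq_zsmul]; abel
        rw [e]
        have h1 : ‖(t - round t) • u‖ ≤ 1 / 2 * ‖u‖ := by
          rw [norm_smul, Real.norm_eq_abs]
          exact mul_le_mul_of_nonneg_right (abs_sub_round t) hupos.le
        have h2 := norm_sub_le y ((t - round t) • u)
        have h3 : ‖y‖ < ‖π x‖ + ‖u‖ / 4 := hyn
        show _ ≤ ‖π x‖ + _
        linarith
    have hΓ' : ∀ ρ : ℝ, {q | q ∈ Γ' ∧ ‖q‖ ≤ ρ}.Finite := by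
      intro ρ
      refine ((hΓ (ρ + 3 / 4 * ‖u‖)).image π).subset ?_
      rintro q ⟨hq, hqρ⟩
      obtain ⟨x, hx, hxq, hxn⟩ := hlift q hq
      exact ⟨x, ⟨hx, by linarith⟩, hxq⟩
    obtain ⟨r, hr, v', N', hv', hind, hcov⟩ := ih Q hQ Γ' hΓ' R hR
    choose w hwΓ hwπ hwn using fun i => hlift (v' i) (hv' i).1
    have hv'0 : ∀ i, v' i ≠ 0 := by
      intro i h
      have := hind (Pi.single i 1) (by
        rw [Finset.sum_eq_single i]
        · simp [h]
        · intro j _ hj; simp [hj]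
        · simp)
      simpa using congrFun this i
    have hw4 : ∀ i, ‖w i‖ ≤ 4 * ‖v' i‖ := by
      intro i
      have h1 := humin (w i) (hwΓ i) (by
        intro h; apply hv'0 i; rw [← hwπ i, h, map_zero])
      have h2 := hwn i
      linarith
    have hwN : ∀ i, (N' i : ℝ) * ‖w i‖ ≤ 4 * C * R := by
      intro i
      have h1 := (hv' i).2.2
      have h2 := mul_le_mul_of_nonneg_left (hw4 i) (Nat.cast_nonneg (N' i) : (0 : ℝ) ≤ _)
      nlinarith
    have hCR : 0 < C * R := by positivity
    have hdr : (r : ℝ) ≤ d := by exact_mod_cast hr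
    set B : ℝ := (1 + 4 * (d + 1) * C) * R with hB
    have hBR : R ≤ B := by
      have : 0 ≤ 4 * ((d : ℝ) + 1) * (C * R) := by positivity
      rw [hB]; nlinarith
    have hBsum : R + r * (4 * C * R) ≤ B := by
      rw [hB]; nlinarith
    refine ⟨r + 1, by omega, Fin.cons u w, Fin.cons ⌊B / ‖u‖⌋₊ N', ?_, ?_, ?_⟩
    · intro i
      refine Fin.cases ?_ (fun i => ?_) i
      · simp only [Fin.cons_zero]
        refine ⟨huΓ, ?_, ?_⟩
        · rw [Nat.one_le_floor_iff, le_div_iff₀ hupos]; linarith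
        · rw [← le_div_iff₀ hupos]
          exact Nat.floor_le (by positivity)
      · simp only [Fin.cons_succ]
        refine ⟨hwΓ i, (hv' i).2.1, (hwN i).trans ?_⟩
        rw [hB]; nlinarith [(Nat.cast_nonneg d : (0 : ℝ) ≤ d)]
    · intro m hm
      rw [Fin.sum_univ_succ] at hm
      simp only [Fin.cons_zero, Fin.cons_succ] at hm
      have hπu : π u = 0 := (Submodule.Quotient.mk_eq_zero L).2 (Submodule.mem_span_singleton_self u)
      have h1 : ∑ i : Fin r, m i.succ • v' i = 0 := by
        have := congrArg π hm
        simpa [map_add, map_sum, map_zsmul, hπu, hwπ] using this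
      have h2 := hind (fun i => m i.succ) h1
      have h3 : ∀ i : Fin r, m i.succ = 0 := fun i => congrFun h2 i
      simp only [h3, zero_smul, Finset.sum_const_zero, add_zero] at hm
      have h4 : m 0 = 0 := by
        rw [← Int.cast_smul_eq_zsmul ℝ] at hm
        rcases smul_eq_zero.1 hm with h | h
        · exact_mod_cast h
        · exact absurd h hu0
      funext i
      refine Fin.cases h4 h3 i
    · intro x hx hxR
      obtain ⟨m', hm'N, hm'⟩ := hcov (π x) ⟨x, hx, rfl⟩
        ((Submodule.Quotient.norm_mk_le L x).trans hxR)
      have hmem : x - ∑ i, m' i • w i ∈ L := by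
        rw [← Submodule.Quotient.mk_eq_zero L]
        show π _ = 0
        rw [map_sub, map_sum, hm']
        simp [map_zsmul, hwπ]
      obtain ⟨t, ht⟩ := Submodule.mem_span_singleton.1 hmem
      have hΓt : (t - round t) • u ∈ Γ := by
        have : (t - round t) • u = (x - ∑ i, m' i • w i) - round t • u := by
          rw [sub_smul, ht, Int.cast_smul_eq_zsmul]
        rw [this]
        exact Γ.sub_mem (Γ.sub_mem hx (Γ.sum_mem fun i _ => Γ.zsmul_mem (hwΓ i) _))
          (Γ.zsmul_mem huΓ _)
      have hz : (t - round t) • u = 0 := by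
        by_contra h
        have h1 := humin _ hΓt h
        rw [norm_smul, Real.norm_eq_abs] at h1
        nlinarith [abs_sub_round t]
      have ht' : t = round t := by
        rcases smul_eq_zero.1 hz with h | h
        · linarith
        · exact absurd h hu0
      have hxe : x = round t • u + ∑ i, m' i • w i := by
        rw [← Int.cast_smul_eq_zsmul ℝ, ← ht', ht]; abel
      refine ⟨Fin.cons (round t) m', ?_, ?_⟩
      · intro i
        refine Fin.cases ?_ (fun i => ?_) i
        · simp only [Fin.cons_zero]
          have hsum : ‖∑ i, m' i • w i‖ ≤ r * (4 * C * R) := by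
            calc ‖∑ i, m' i • w i‖ ≤ ∑ i : Fin r, (4 * C * R) := by
                  refine norm_sum_le_of_le _ fun i _ => ?_
                  rw [← Int.cast_smul_eq_zsmul ℝ, norm_smul, Real.norm_eq_abs]
                  refine le_trans ?_ (hwN i)
                  refine mul_le_mul_of_nonneg_right ?_ (norm_nonneg _)
                  exact_mod_cast hm'N i
              _ = r * (4 * C * R) := by simp
          have h1 : |(round t : ℝ)| * ‖u‖ ≤ B := by
            rw [← Real.norm_eq_abs, ← norm_smul, Int.cast_smul_eq_zsmul]
            have : round t • u = x - ∑ i, m' i • w i := by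
              rw [eq_sub_iff_add_eq]; exact hxe.symm
            rw [this]
            have := norm_sub_le x (∑ i, m' i • w i)
            linarith
          rw [← le_div_iff₀ hupos] at h1
          rw [Int.abs_eq_natAbs]
          norm_cast
          refine Nat.le_floor ?_
          rwa [Nat.cast_natAbs, Int.cast_abs]
        · simpa using hm'N i
      · rw [Fin.sum_univ_succ]
        simpa using hxe

section Fourier

/-- The number of representations of `y` as a sum of two elements of `A`. -/
def sumRep {G : Type*} [AddCommGroup G] [DecidableEq G] (A : Finset G) (y : G) : ℕ :=
  ((A ×ˢ A).filter fun p => p.1 + p.2 = y).card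

theorem exists_of_sumRep_ne_zero {G : Type*} [AddCommGroup G] [DecidableEq G] {A : Finset G}
    {y : G} (hy : sumRep A y ≠ 0) :
    ∃ a ∈ A, ∃ b ∈ A, a + b = y := by
  obtain ⟨p, hp⟩ := Finset.card_ne_zero.1 hy
  rw [Finset.mem_filter, Finset.mem_product] at hp
  exact ⟨p.1, hp.1.1, p.2, hp.1.2, hp.2⟩

variable {G : Type*} [AddCommGroup G] [Fintype G]

open ComplexConjugate in
theorem sum_addChar_norm_sq_mul (r : G → ℝ) (x : G) :
    ∑ χ : AddChar G ℂ, ((‖∑ y, (r y : ℂ) * χ y‖ ^ 2 : ℝ) : ℂ) * χ x =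
      Fintype.card G * ∑ y, (r y : ℂ) * r (y + x) := by
  classical
  have h1 : ∀ χ : AddChar G ℂ, ((‖∑ y, (r y : ℂ) * χ y‖ ^ 2 : ℝ) : ℂ) * χ x =
      ∑ y, ∑ z, (r y : ℂ) * r z * χ (y + x - z) := by
    intro χ
    push_cast
    rw [← Complex.mul_conj', map_sum, Finset.sum_mul_sum, Finset.sum_mul]
    refine Finset.sum_congr rfl fun y _ => ?_
    rw [Finset.sum_mul]
    refine Finset.sum_congr rfl fun z _ => ?_
    rw [sub_eq_add_neg, AddChar.map_add_eq_mul, AddChar.map_add_eq_mul, AddChar.map_neg_eq_conj,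
      map_mul, Complex.conj_ofReal]
    ring
  simp_rw [h1]
  rw [Finset.sum_comm, Finset.mul_sum]
  refine Finset.sum_congr rfl fun y _ => ?_
  rw [Finset.sum_comm, Finset.sum_eq_single (y + x)]
  · rw [← Finset.mul_sum, AddChar.sum_apply_eq_ite]
    simp [mul_comm]
  · intro z _ hz
    rw [← Finset.mul_sum, AddChar.sum_apply_eq_ite, if_neg (sub_ne_zero.2 hz.symm), mul_zero]
  · simp

theorem sum_addChar_norm_sq (r : G → ℝ) :
    ∑ χ : AddChar G ℂ, ‖∑ y, (r y : ℂ) * χ y‖ ^ 2 = Fintype.card G * ∑ y, r y ^ 2 := by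
  have h := sum_addChar_norm_sq_mul r 0
  simp only [AddChar.map_zero_eq_one, mul_one, add_zero, ← sq] at h
  exact_mod_cast h

theorem sum_addChar_norm_sq_finset (A : Finset G) :
    ∑ χ : AddChar G ℂ, ‖∑ a ∈ A, χ a‖ ^ 2 = Fintype.card G * (A.card : ℝ) := by
  classical
  simpa [apply_ite (fun t : ℝ => (t : ℂ))] using
    sum_addChar_norm_sq (fun y => if y ∈ A then (1 : ℝ) else 0)

theorem norm_one_sub_mul_norm_sum_le [DecidableEq G] (A : Finset G) (y : G) (χ : AddChar G ℂ) :
    ‖1 - χ y‖ * ‖∑ a ∈ A, χ a‖ ≤ 2 * ((A.image (· + y) \ A).card : ℝ) := by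
  set B := A.image (· + y) with hB
  have hc : B.card = A.card := Finset.card_image_of_injective _ (add_left_injective y)
  have h1 : ∑ a ∈ B, χ a = χ y * ∑ a ∈ A, χ a := by
    rw [hB, Finset.sum_image (fun a _ b _ h => add_left_injective y h), Finset.mul_sum]
    exact Finset.sum_congr rfl fun a _ => by rw [AddChar.map_add_eq_mul, mul_comm]
  have hcc : (A \ B).card = (B \ A).card := Finset.card_sdiff_comm hc.symm
  have hb : ∀ s : Finset G, ‖∑ a ∈ s, χ a‖ ≤ s.card := fun s => by
    simpa using norm_sum_le_of_le s (f := fun a => χ a) (n := fun _ => (1 : ℝ))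
      (fun a _ => (AddChar.norm_apply χ a).le)
  rw [← norm_mul, sub_mul, one_mul, ← h1, ← Finset.sum_sdiff_sub_sum_sdiff]
  have h2 := hb (A \ B)
  have h3 := hb (B \ A)
  have h4 := norm_sub_le (∑ a ∈ A \ B, χ a) (∑ a ∈ B \ A, χ a)
  rw [hcc] at h2
  linarith

theorem sum_sumRep_mul [DecidableEq G] (A : Finset G) (χ : AddChar G ℂ) :
    ∑ y, ((sumRep A y : ℝ) : ℂ) * χ y = (∑ a ∈ A, χ a) ^ 2 := by
  rw [sq, Finset.sum_mul_sum, ← Finset.sum_product',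
    ← Finset.sum_fiberwise (A ×ˢ A) (fun p => p.1 + p.2)]
  refine Finset.sum_congr rfl fun y _ => ?_
  rw [Finset.sum_congr rfl (g := fun _ => χ y)]
  · simp [sumRep]
  · intro p hp
    rw [← AddChar.map_add_eq_mul, (Finset.mem_filter.1 hp).2]

theorem card_pow_four_le [DecidableEq G] (A : Finset G) :
    Fintype.card G * (A.card : ℝ) ^ 4 ≤
      (A + A).card * ∑ χ : AddChar G ℂ, ‖∑ a ∈ A, χ a‖ ^ 4 := by
  have h4 : ∑ χ : AddChar G ℂ, ‖∑ a ∈ A, χ a‖ ^ 4 =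
      Fintype.card G * ∑ y, (sumRep A y : ℝ) ^ 2 := by
    rw [← sum_addChar_norm_sq]
    refine Finset.sum_congr rfl fun χ _ => ?_
    rw [sum_sumRep_mul, norm_pow, ← pow_mul]
  have h6 : (A.card : ℝ) ^ 2 = ∑ y ∈ A + A, (sumRep A y : ℝ) := by
    have : (A ×ˢ A).card = ∑ y ∈ A + A, sumRep A y :=
      Finset.card_eq_sum_card_fiberwise (s := A ×ˢ A) (t := A + A) (f := fun p => p.1 + p.2)
        fun p hp => Finset.add_mem_add (Finset.mem_product.1 hp).1 (Finset.mem_product.1 hp).2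
    rw [Finset.card_product, ← sq] at this
    exact_mod_cast this
  have h7 := sq_sum_le_card_mul_sum_sq (s := A + A) (f := fun y => (sumRep A y : ℝ))
  rw [← h6, ← pow_mul] at h7
  have h8 : ∑ y ∈ A + A, (sumRep A y : ℝ) ^ 2 ≤ ∑ y, (sumRep A y : ℝ) ^ 2 :=
    Finset.sum_le_sum_of_subset_of_nonneg (Finset.subset_univ _) fun _ _ _ => sq_nonneg _
  rw [h4, mul_left_comm]
  refine mul_le_mul_of_nonneg_left (h7.trans ?_) (Nat.cast_nonneg _)
  exact mul_le_mul_of_nonneg_left h8 (Nat.cast_nonneg _)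

theorem sum_norm_pow_four_mul_re_eq_zero [DecidableEq G] (A : Finset G) (x : G)
    (hx : ∀ a ∈ A, ∀ b ∈ A, ∀ c ∈ A, ∀ d ∈ A, x ≠ c + d - (a + b)) :
    ∑ χ : AddChar G ℂ, ‖∑ a ∈ A, χ a‖ ^ 4 * (χ x).re = 0 := by
  have hzero : ∑ y, ((sumRep A y : ℝ) : ℂ) * (sumRep A (y + x) : ℝ) = 0 := by
    refine Finset.sum_eq_zero fun y _ => ?_
    by_contra h
    obtain ⟨a, ha, b, hb, hab⟩ := exists_of_sumRep_ne_zero (A := A) (y := y)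
      fun h' => h (by simp [h'])
    obtain ⟨c, hc, d, hd, hcd⟩ := exists_of_sumRep_ne_zero (A := A) (y := y + x)
      fun h' => h (by simp [h'])
    exact hx a ha b hb c hc d hd (by rw [hcd, hab]; abel)
  have h0 := sum_addChar_norm_sq_mul (fun y => (sumRep A y : ℝ)) x
  rw [hzero, mul_zero] at h0
  have h1 := congrArg Complex.re h0
  rw [Complex.re_sum, Complex.zero_re] at h1
  rw [← h1]
  refine Finset.sum_congr rfl fun χ _ => ?_
  rw [sum_sumRep_mul, Complex.re_ofReal_mul, norm_pow, ← pow_mul]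

/-- Bogolyubov's lemma for the large spectrum of a set of small doubling. -/
theorem exists_add_sub_of_spectrum [DecidableEq G] (A : Finset G) (hA : A.Nonempty) (K ν : ℝ)
    (hK : ((A + A).card : ℝ) ≤ K * A.card) (hKν : 3 * ν ^ 2 * K < 1) (x : G)
    (hx : ∀ χ : AddChar G ℂ, ν * A.card ≤ ‖∑ a ∈ A, χ a‖ → 1 / 2 ≤ (χ x).re) :
    ∃ a ∈ A, ∃ b ∈ A, ∃ c ∈ A, ∃ d ∈ A, x = c + d - (a + b) := by
  by_contra hcon
  push Not at hcon
  have h0 := sum_norm_pow_four_mul_re_eq_zero A x hcon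
  have hP := sum_addChar_norm_sq_finset A
  have hE := card_pow_four_le A
  have hG : (0 : ℝ) < Fintype.card G := by exact_mod_cast Fintype.card_pos
  have ha : (0 : ℝ) < A.card := by exact_mod_cast hA.card_pos
  have hterm : ∀ χ : AddChar G ℂ, 1 / 2 * ‖∑ a ∈ A, χ a‖ ^ 4 -
      3 / 2 * (ν * A.card) ^ 2 * ‖∑ a ∈ A, χ a‖ ^ 2 ≤ ‖∑ a ∈ A, χ a‖ ^ 4 * (χ x).re := by
    intro χ
    have hx' := hx χ
    have hf0 : 0 ≤ ‖∑ a ∈ A, χ a‖ := norm_nonneg _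
    generalize ‖∑ a ∈ A, χ a‖ = f at *
    have h8 : 0 ≤ f ^ 4 := by positivity
    by_cases h : ν * A.card ≤ f
    · have := hx' h
      have h9 : 0 ≤ 3 / 2 * (ν * A.card) ^ 2 * f ^ 2 := by positivity
      nlinarith
    · push Not at h
      have h10 : -1 ≤ (χ x).re := by
        have := Complex.abs_re_le_norm (χ x)
        rw [AddChar.norm_apply] at this
        exact (abs_le.1 this).1
      have h8' : f ^ 2 ≤ (ν * A.card) ^ 2 := by gcongr
      have h9 : f ^ 4 ≤ (ν * A.card) ^ 2 * f ^ 2 := by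
        have := mul_le_mul_of_nonneg_right h8' (sq_nonneg f)
        nlinarith
      nlinarith
  have hsum := Finset.sum_le_sum fun χ (_ : χ ∈ Finset.univ) => hterm χ
  rw [h0, Finset.sum_sub_distrib, ← Finset.mul_sum, ← Finset.mul_sum, hP] at hsum
  generalize ∑ χ : AddChar G ℂ, ‖∑ a ∈ A, χ a‖ ^ 4 = E at *
  generalize (Fintype.card G : ℝ) = g at *
  generalize (A.card : ℝ) = a at *
  have h12 : E ≤ 3 * ν ^ 2 * a ^ 3 * g := by nlinarith
  have h13 : g * a ^ 4 ≤ K * a * (3 * ν ^ 2 * a ^ 3 * g) := by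
    refine hE.trans (mul_le_mul hK h12 ?_ ((Nat.cast_nonneg _).trans hK))
    by_contra hneg
    push Not at hneg
    have : ((A + A).card : ℝ) * E ≤ 0 :=
      mul_nonpos_of_nonneg_of_nonpos (Nat.cast_nonneg _) hneg.le
    have : 0 < g * a ^ 4 := by positivity
    linarith
  have h14 : 0 < g * a ^ 4 := by positivity
  have h15 : g * a ^ 4 * (3 * ν ^ 2 * K) < g * a ^ 4 * 1 := mul_lt_mul_of_pos_left hKν h14
  nlinarith

theorem mul_abs_arg_le {z : ℂ} (hz : ‖z‖ = 1) (j : ℕ) (h : ∀ i ≤ j, ‖1 - z ^ i‖ ≤ 1) :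
    j * |z.arg| ≤ Real.pi / 3 := by
  have hexp : ∀ i : ℕ, (z ^ i).re = Real.cos (i * z.arg) := by
    intro i
    have : z = Complex.exp (z.arg * Complex.I) := by
      have := Complex.norm_mul_exp_arg_mul_I z
      rw [hz] at this
      simpa using this.symm
    conv_lhs => rw [this]
    rw [← Complex.exp_nat_mul, ← mul_assoc]
    have := Complex.exp_ofReal_mul_I_re (i * z.arg)
    push_cast at this
    exact this
  have hcos : ∀ i ≤ j, 1 / 2 ≤ Real.cos (i * |z.arg|) := by
    intro i hi
    have h1 := h i hi
    have h2 : (z ^ i).re = Real.cos (i * |z.arg|) := by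
      rw [hexp, ← Real.cos_abs, abs_mul, Nat.abs_cast]
    rw [← h2]
    have h3 : ‖z ^ i‖ = 1 := by rw [norm_pow, hz, one_pow]
    have h4 : ‖1 - z ^ i‖ ^ 2 ≤ 1 := by
      have := norm_nonneg (1 - z ^ i)
      nlinarith
    rw [← Complex.normSq_eq_norm_sq, Complex.normSq_apply] at h4
    have h5 : (z ^ i).re * (z ^ i).re + (z ^ i).im * (z ^ i).im = 1 := by
      rw [← Complex.normSq_apply, Complex.normSq_eq_norm_sq, h3, one_pow]
    simp only [Complex.sub_re, Complex.one_re, Complex.sub_im, Complex.one_im] at h4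
    nlinarith
  have key : ∀ t : ℝ, 0 ≤ t → t ≤ Real.pi → 1 / 2 ≤ Real.cos t → t ≤ Real.pi / 3 := by
    intro t h0 h1 h2
    by_contra hlt
    push Not at hlt
    have := Real.cos_lt_cos_of_nonneg_of_le_pi (by positivity) h1 hlt
    rw [Real.cos_pi_div_three] at this
    linarith
  have hpi := Real.pi_pos
  have : ∀ i ≤ j, i * |z.arg| ≤ Real.pi / 3 := by
    intro i
    induction i with
    | zero => intro _; simp; positivity
    | succ i ih =>
      intro hi
      have h1 := ih (by omega)
      have harg := Complex.abs_arg_le_pi z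
      rcases Nat.eq_zero_or_pos i with rfl | hipos
      · refine key _ (by positivity) (by simpa using harg) (hcos _ hi)
      · refine key _ (by positivity) ?_ (hcos _ hi)
        have : (1 : ℝ) ≤ i := by exact_mod_cast hipos
        push_cast
        nlinarith [abs_nonneg z.arg]
  exact this j le_rfl

end Fourier

section BallGrowth

open Classical in
/-- The closed ball of radius `t` about `0` for a seminorm on a finite group. -/
noncomputable def AddGroupSeminorm.finBall {G : Type*} [AddCommGroup G] [Fintype G]
    (p : AddGroupSeminorm G) (t : ℝ) : Finset G :=
  Finset.univ.filter fun x => p x ≤ t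

variable {G : Type*} [AddCommGroup G] [Fintype G]

theorem AddGroupSeminorm.mem_finBall {p : AddGroupSeminorm G} {t : ℝ} {x : G} :
    x ∈ p.finBall t ↔ p x ≤ t := by
  classical
  simp [AddGroupSeminorm.finBall]

theorem AddGroupSeminorm.finBall_mono (p : AddGroupSeminorm G) {s t : ℝ} (h : s ≤ t) :
    p.finBall s ⊆ p.finBall t := fun _ hx =>
  AddGroupSeminorm.mem_finBall.2 ((AddGroupSeminorm.mem_finBall.1 hx).trans h)

theorem AddGroupSeminorm.card_finBall_mono (p : AddGroupSeminorm G) {s t : ℝ} (h : s ≤ t) :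
    ((p.finBall s).card : ℝ) ≤ (p.finBall t).card := by
  exact_mod_cast Finset.card_le_card (p.finBall_mono h)

theorem AddGroupSeminorm.card_finBall_pos (p : AddGroupSeminorm G) {t : ℝ} (h : 0 ≤ t) :
    0 < (p.finBall t).card :=
  Finset.card_pos.2 ⟨0, AddGroupSeminorm.mem_finBall.2 (by simpa using h)⟩

/-- A bounded increasing sequence has a step where it grows by a factor at most `1 + η`. -/
theorem exists_slow_growth_step (f : ℕ → ℝ) (J : ℕ) (η K : ℝ) (hη : 0 ≤ η) (hf0 : 0 < f 0)
    (hfJ : f J ≤ K * f 0) (hK : K < (1 + η) ^ J) : ∃ j < J, f (j + 1) ≤ (1 + η) * f j := by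
  by_contra hcon
  push Not at hcon
  have : ∀ j ≤ J, (1 + η) ^ j * f 0 ≤ f j := by
    intro j
    induction j with
    | zero => simp
    | succ j ih =>
      intro hj
      have h1 := ih (by omega)
      have h2 := hcon j (by omega)
      have h3 := mul_le_mul_of_nonneg_left h1 (by positivity : 0 ≤ 1 + η)
      rw [pow_succ]
      nlinarith
  have h1 := this J le_rfl
  nlinarith

theorem half_le_re_of_abs_arg_le_one {z : ℂ} (hz : ‖z‖ = 1) (h : |z.arg| ≤ 1) :
    1 / 2 ≤ z.re := by
  have h1 : z.re = Real.cos |z.arg| := by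
    have := Complex.norm_mul_cos_arg z
    rw [hz, one_mul] at this
    rw [Real.cos_abs, this]
  rw [h1, ← Real.cos_pi_div_three]
  have := Real.pi_gt_three
  exact Real.cos_le_cos_of_nonneg_of_le_pi (abs_nonneg _) (by linarith) (by linarith)

/-- At a scale where balls of a seminorm have small doubling, they are sandwiched between Bohr
sets of a common set of characters. -/
theorem exists_bohr_sandwich (K : ℝ) (hK : 1 ≤ K) : ∃ δ : ℝ, 0 < δ ∧
    ∀ (G : Type) [AddCommGroup G] [Fintype G] (p : AddGroupSeminorm G) (s : ℝ), 0 < s →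
      ((p.finBall (8 * s)).card : ℝ) ≤ K * (p.finBall s).card →
      ∃ S : Set (AddChar G ℂ),
        (∀ x, (∀ χ ∈ S, |(χ x).arg| ≤ 1) → p x ≤ 8 * s) ∧
        ∀ x, p x ≤ 1 → ∀ χ ∈ S, ∀ j : ℕ, j ≤ δ * s → j * |(χ x).arg| ≤ 2 := by
  set ν : ℝ := 1 / (2 * K) with hν
  have hK0 : 0 < K := by linarith
  have hν0 : 0 < ν := by positivity
  have hKν : 3 * ν ^ 2 * K < 1 := by
    rw [hν]; field_simp; nlinarith
  obtain ⟨J, hJ⟩ := pow_unbounded_of_one_lt K (by linarith : 1 < 1 + ν / 2)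
  have hJ0 : J ≠ 0 := by
    rintro rfl
    simp at hJ; linarith
  have hJpos : (0 : ℝ) < J := by positivity
  refine ⟨1 / J, by positivity, ?_⟩
  intro G _ _ p s hs hdoub
  classical
  obtain ⟨j, hjJ, hj⟩ := exists_slow_growth_step
    (fun j => ((p.finBall (s + j / J * s)).card : ℝ)) J (ν / 2) K (by positivity)
    (by exact_mod_cast p.card_finBall_pos (by positivity))
    (by
      refine (p.card_finBall_mono ?_).trans (hdoub.trans ?_)
      · rw [div_self hJpos.ne']; linarith
      · simp) hJ
  set t : ℝ := s + j / J * s with ht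
  have hjJ' : (j : ℝ) / J ≤ 1 := by
    rw [div_le_one hJpos]; exact_mod_cast hjJ.le
  have hjJ0 : 0 ≤ (j : ℝ) / J := by positivity
  have hts : s ≤ t := by nlinarith
  have ht2 : t ≤ 2 * s := by nlinarith
  have ht' : s + ((j + 1 : ℕ) : ℝ) / J * s = t + 1 / J * s := by
    rw [ht]; push_cast; ring
  rw [ht'] at hj
  set A := p.finBall t with hA
  have hApos : (0 : ℝ) < A.card := by exact_mod_cast p.card_finBall_pos (hs.le.trans hts)
  have hAne : A.Nonempty := Finset.card_pos.1 (by exact_mod_cast hApos)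
  have hAmem : ∀ {a}, a ∈ A → p a ≤ t := fun h => AddGroupSeminorm.mem_finBall.1 h
  have hAA : ((A + A).card : ℝ) ≤ K * A.card := by
    have h1 : A + A ⊆ p.finBall (8 * s) := by
      intro x hx
      obtain ⟨a, ha, b, hb, rfl⟩ := Finset.mem_add.1 hx
      have := map_add_le_add p a b
      exact AddGroupSeminorm.mem_finBall.2 (by linarith [hAmem ha, hAmem hb])
    calc ((A + A).card : ℝ) ≤ (p.finBall (8 * s)).card := by
          exact_mod_cast Finset.card_le_card h1
      _ ≤ K * (p.finBall s).card := hdoub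
      _ ≤ K * A.card := mul_le_mul_of_nonneg_left (p.card_finBall_mono hts) hK0.le
  refine ⟨{χ | ν * A.card ≤ ‖∑ a ∈ A, χ a‖}, ?_, ?_⟩
  · intro x hx
    obtain ⟨a, ha, b, hb, c, hc, d, hd, rfl⟩ := exists_add_sub_of_spectrum A hAne K ν hAA hKν x
      fun χ hχ => half_le_re_of_abs_arg_le_one (AddChar.norm_apply χ x) (hx χ hχ)
    have h1 := map_sub_le_add p (c + d) (a + b)
    have h2 := map_add_le_add p c d
    have h3 := map_add_le_add p a b
    linarith [hAmem ha, hAmem hb, hAmem hc, hAmem hd]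
  · intro x hx χ hχ i hi
    have hχ' : ν * A.card ≤ ‖∑ a ∈ A, χ a‖ := hχ
    have hpi := Real.pi_lt_four
    refine (mul_abs_arg_le (AddChar.norm_apply χ x) i fun k hk => ?_).trans (by linarith)
    rw [← AddChar.map_nsmul_eq_pow]
    have hpk : p (k • x) ≤ 1 / J * s := by
      have h1 : p (k • x) ≤ k * p x := by
        clear hk
        induction k with
        | zero => simp
        | succ k ih =>
          rw [succ_nsmul]; push_cast
          linarith [map_add_le_add p (k • x) x]
      have h2 : (k : ℝ) ≤ i := by exact_mod_cast hk
      have h3 : 0 ≤ p x := apply_nonneg p x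
      nlinarith [(Nat.cast_nonneg k : (0 : ℝ) ≤ k)]
    have h1 := norm_one_sub_mul_norm_sum_le A (k • x) χ
    have h2 : A.image (· + k • x) \ A ⊆ p.finBall (t + 1 / J * s) \ A := by
      refine Finset.sdiff_subset_sdiff ?_ le_rfl
      intro y hy
      obtain ⟨a, ha, rfl⟩ := Finset.mem_image.1 hy
      exact AddGroupSeminorm.mem_finBall.2
        ((map_add_le_add p a _).trans (add_le_add (hAmem ha) hpk))
    have h3 : ((A.image (· + k • x) \ A).card : ℝ) ≤ (p.finBall (t + 1 / J * s)).card - A.card := by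
      have hsub : A ⊆ p.finBall (t + 1 / J * s) :=
        p.finBall_mono (le_add_of_nonneg_right (by positivity))
      have h4 := Finset.card_le_card h2
      rw [Finset.card_sdiff_of_subset hsub] at h4
      have h5 := Finset.card_le_card hsub
      rw [← Nat.cast_sub h5]
      exact_mod_cast h4
    have h6 : ‖1 - χ (k • x)‖ * (ν * A.card) ≤ ν * A.card := by
      have := mul_le_mul_of_nonneg_left hχ' (norm_nonneg (1 - χ (k • x)))
      linarith
    have h7 : 0 < ν * A.card := by positivity
    exact le_of_mul_le_mul_right (by linarith) h7

end BallGrowth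

section GAP

open Pointwise

/-- The set of coefficient vectors `m` with `|m i| ≤ N i`. -/
noncomputable def coeffBox {r : ℕ} (N : Fin r → ℕ) : Finset (Fin r → ℤ) :=
  Fintype.piFinset fun i => Finset.Icc (-(N i : ℤ)) (N i)

theorem mem_coeffBox {r : ℕ} {N : Fin r → ℕ} {m : Fin r → ℤ} :
    m ∈ coeffBox N ↔ ∀ i, |m i| ≤ N i := by
  simp [coeffBox, abs_le]

theorem card_coeffBox {r : ℕ} (N : Fin r → ℕ) :
    (coeffBox N).card = ∏ i, (2 * N i + 1) := by
  rw [coeffBox, Fintype.card_piFinset]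
  refine Finset.prod_congr rfl fun i _ => ?_
  rw [Int.card_Icc]
  omega

/-- The symmetric GAP with generators `g` and dimensions `N`. -/
def symmGAP {G : Type*} [AddCommGroup G] {r : ℕ} (g : Fin r → G) (N : Fin r → ℕ) :
    GAPData G r where
  g₀ := 0
  g := g
  N i := -(N i : ℤ)
  N' i := N i
  hle i := by simp

theorem symmGAP_toSet {G : Type*} [AddCommGroup G] {r : ℕ} (g : Fin r → G) (N : Fin r → ℕ) :
    (symmGAP g N).toSet = (fun m : Fin r → ℤ => ∑ i, m i • g i) '' (coeffBox N : Set _) := by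
  ext x
  simp only [GAPData.toSet, symmGAP, Set.mem_ofPred_eq, Set.mem_image, Finset.mem_coe,
    mem_coeffBox, abs_le, zero_add]
  exact ⟨fun ⟨m, h1, h2⟩ => ⟨m, h1, h2.symm⟩, fun ⟨m, h1, h2⟩ => ⟨m, h1, h2.symm⟩⟩

theorem symmGAP_properties {G : Type*} [AddCommGroup G] [Finite G] {r : ℕ} (H : AddSubgroup G)
    (g : Fin r → G) (N : Fin r → ℕ)
    (hinj : ∀ m ∈ coeffBox N, ∀ m' ∈ coeffBox N,
      ∑ i, m i • g i - ∑ i, m' i • g i ∈ H → m = m') :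
    (symmGAP g N).IsSymmetric ∧ IsProperCosetProg H (symmGAP g N) ∧
      ((H : Set G) + (symmGAP g N).toSet).ncard = Nat.card H * ∏ i, (2 * N i + 1) := by
  have hcard : (symmGAP g N).toSet.ncard = ∏ i, (2 * N i + 1) := by
    rw [symmGAP_toSet, Set.InjOn.ncard_image, Set.ncard_coe_finset, card_coeffBox]
    intro m hm m' hm' h
    refine hinj m hm m' hm' ?_
    simp only at h
    rw [h, sub_self]
    exact H.zero_mem
  have hsum : ((H : Set G) + (symmGAP g N).toSet).ncard =
      (H : Set G).ncard * (symmGAP g N).toSet.ncard := by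
    rw [← Set.ncard_prod, ← Set.add_image_prod]
    refine Set.InjOn.ncard_image ?_
    rintro ⟨h, x⟩ ⟨hh, hx⟩ ⟨h', x'⟩ ⟨hh', hx'⟩ he
    simp only at hh hx hh' hx' he
    rw [symmGAP_toSet] at hx hx'
    obtain ⟨m, hm, rfl⟩ := hx
    obtain ⟨m', hm', rfl⟩ := hx'
    simp only at he
    have hmm : m = m' := by
      refine hinj m hm m' hm' ?_
      have : ∑ i, m i • g i - ∑ i, m' i • g i = h' - h := by
        rw [sub_eq_sub_iff_add_eq_add, add_comm, he]
      rw [this]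
      exact H.sub_mem hh' hh
    subst hmm
    simpa using he
  refine ⟨⟨rfl, fun i => rfl⟩, ⟨Set.toFinite _, ?_, hsum⟩, ?_⟩
  · intro m m' hm hm' h
    refine hinj m (mem_coeffBox.2 fun i => abs_le.2 (hm i)) m'
      (mem_coeffBox.2 fun i => abs_le.2 (hm' i)) ?_
    have h' : ∑ i, m i • g i = ∑ i, m' i • g i := by
      simpa [symmGAP] using h
    rw [h', sub_self]
    exact H.zero_mem
  · rw [hsum, hcard]
    rfl

end GAP

section Lift

theorem arg_exp_mul_I_of_abs_le_two {t : ℝ} (ht : |t| ≤ 2) :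
    (Complex.exp (t * Complex.I)).arg = t := by
  rw [Complex.arg_exp_mul_I, toIocMod_eq_self]
  have := Real.pi_gt_three
  have := abs_le.1 ht
  constructor <;> linarith

theorem exp_arg_mul_I_of_norm_one {z : ℂ} (hz : ‖z‖ = 1) :
    Complex.exp (z.arg * Complex.I) = z := by
  have := Complex.norm_mul_exp_arg_mul_I z
  rwa [hz, Complex.ofReal_one, one_mul] at this

theorem finite_bounded_exp_fiber (ρ : ℝ) (z : ℂ) :
    {t : ℝ | |t| ≤ ρ ∧ Complex.exp (t * Complex.I) = z}.Finite := by
  rcases Set.eq_empty_or_nonempty {t : ℝ | |t| ≤ ρ ∧ Complex.exp (t * Complex.I) = z} with h | h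
  · rw [h]; exact Set.finite_empty
  obtain ⟨t₀, ht₀, hz⟩ := h
  refine ((Set.finite_Icc (-⌈2 * ρ⌉) ⌈2 * ρ⌉).image fun n : ℤ => t₀ + n * (2 * Real.pi)).subset ?_
  rintro t ⟨ht, htz⟩
  rw [← hz, Complex.exp_eq_exp_iff_exists_int] at htz
  obtain ⟨n, hn⟩ := htz
  have hn' : t = t₀ + n * (2 * Real.pi) := by
    have := congrArg Complex.im hn
    simpa using this
  refine ⟨n, ?_, hn'.symm⟩
  have h1 : |(n : ℝ) * (2 * Real.pi)| ≤ 2 * ρ := by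
    have : (n : ℝ) * (2 * Real.pi) = t - t₀ := by rw [hn']; ring
    rw [this]
    have := abs_sub t t₀
    linarith
  have h2 : |(n : ℝ)| ≤ 2 * ρ := by
    rw [abs_mul, abs_of_pos Real.two_pi_pos] at h1
    have := Real.pi_gt_three
    nlinarith [abs_nonneg (n : ℝ)]
  have h3 : |n| ≤ ⌈2 * ρ⌉ := by
    have := h2.trans (Int.le_ceil _)
    exact_mod_cast this
  exact abs_le.1 h3

variable {G : Type*} [AddCommGroup G] (S : Set (AddChar G ℂ))

/-- The common kernel of a set of characters. -/
def commonKernel : AddSubgroup G where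
  carrier := {x | ∀ χ ∈ S, χ x = 1}
  zero_mem' := fun χ _ => χ.map_zero_eq_one
  add_mem' := fun {x y} hx hy χ hχ => by rw [χ.map_add_eq_mul, hx χ hχ, hy χ hχ, one_mul]
  neg_mem' := fun {x} hx χ hχ => by rw [χ.map_neg_eq_inv, hx χ hχ, inv_one]

/-- The real vectors which are phases, modulo `2π`, of a group element at the characters in `S`. -/
def phaseLattice : AddSubgroup (S → ℝ) where
  carrier := {v | ∃ x : G, ∀ χ : S, Complex.exp (v χ * Complex.I) = (χ : AddChar G ℂ) x}
  zero_mem' := ⟨0, fun _ => by simp⟩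
  add_mem' := by
    rintro v w ⟨x, hx⟩ ⟨y, hy⟩
    refine ⟨x + y, fun χ => ?_⟩
    rw [AddChar.map_add_eq_mul, ← hx, ← hy, ← Complex.exp_add, Pi.add_apply, Complex.ofReal_add,
      add_mul]
  neg_mem' := by
    rintro v ⟨x, hx⟩
    refine ⟨-x, fun χ => ?_⟩
    rw [AddChar.map_neg_eq_inv, ← hx, ← Complex.exp_neg, Pi.neg_apply, Complex.ofReal_neg, neg_mul]

open Classical in
/-- A group element with the given phases. -/
noncomputable def phaseLift (v : S → ℝ) : G :=
  if h : v ∈ phaseLattice S then h.choose else 0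

variable {S}

theorem apply_phaseLift {v : S → ℝ} (hv : v ∈ phaseLattice S) (χ : S) :
    (χ : AddChar G ℂ) (phaseLift S v) = Complex.exp (v χ * Complex.I) := by
  rw [phaseLift, dif_pos hv]
  exact (hv.choose_spec χ).symm

theorem AddChar.apply_finset_sum {ι G : Type*} [AddCommGroup G] (χ : AddChar G ℂ)
    (s : Finset ι) (f : ι → G) : χ (∑ i ∈ s, f i) = ∏ i ∈ s, χ (f i) :=
  map_prod χ.toMonoidHom (fun i => Multiplicative.ofAdd (f i)) s

theorem apply_sum_phaseLift {r : ℕ} {v : Fin r → S → ℝ} (hv : ∀ i, v i ∈ phaseLattice S)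
    (m : Fin r → ℤ) (χ : S) :
    (χ : AddChar G ℂ) (∑ i, m i • phaseLift S (v i)) =
      Complex.exp (((∑ i, m i • v i) χ : ℝ) * Complex.I) := by
  rw [AddChar.apply_finset_sum, Finset.sum_apply, Complex.ofReal_sum, Finset.sum_mul,
    Complex.exp_sum]
  refine Finset.prod_congr rfl fun i _ => ?_
  rw [AddChar.map_zsmul_eq_zpow, apply_phaseLift (hv i), ← Complex.exp_int_mul]
  simp [mul_assoc]

variable (S) in
/-- The vector of arguments of `x` at the characters in `S`. -/
noncomputable def phase (x : G) : S → ℝ := fun χ => ((χ : AddChar G ℂ) x).arg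

theorem phase_mem_phaseLattice [Finite G] (x : G) : phase S x ∈ phaseLattice S :=
  ⟨x, fun _ => exp_arg_mul_I_of_norm_one (AddChar.norm_apply _ x)⟩

theorem finite_phaseLattice_ball [Finite G] [Fintype S] (ρ : ℝ) :
    {v | v ∈ phaseLattice S ∧ ‖v‖ ≤ ρ}.Finite := by
  refine (Set.finite_iUnion fun x : G => Set.Finite.pi' (fun χ : S =>
    finite_bounded_exp_fiber ρ ((χ : AddChar G ℂ) x))).subset ?_
  rintro v ⟨⟨x, hx⟩, hv⟩
  refine Set.mem_iUnion.2 ⟨x, fun χ => ⟨?_, hx χ⟩⟩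
  exact (norm_le_pi_norm v χ).trans hv

/-- Lattice points of norm at most one, times the common kernel, inject into the Bohr set. -/
theorem card_mul_card_commonKernel_le [Finite G] [Fintype S] (B : Finset G)
    (hB : ∀ x, (∀ χ ∈ S, |(χ x).arg| ≤ 1) → x ∈ B) (T : Finset (S → ℝ))
    (hT : ∀ v ∈ T, v ∈ phaseLattice S ∧ ‖v‖ ≤ 1) :
    T.card * Nat.card (commonKernel S) ≤ B.card := by
  classical
  have harg : ∀ v ∈ T, ∀ h ∈ commonKernel S, ∀ χ : S,
      ((χ : AddChar G ℂ) (phaseLift S v + h)).arg = v χ := by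
    intro v hv h hh χ
    rw [AddChar.map_add_eq_mul, hh χ χ.2, mul_one, apply_phaseLift (hT v hv).1]
    refine arg_exp_mul_I_of_abs_le_two ?_
    have := (norm_le_pi_norm v χ).trans (hT v hv).2
    rw [Real.norm_eq_abs] at this
    linarith
  rw [show Nat.card (commonKernel S) = (commonKernel S : Set G).ncard from rfl,
    ← Set.ncard_coe_finset T, ← Set.ncard_prod, ← Set.ncard_coe_finset B]
  refine Set.ncard_le_ncard_of_injOn (fun q => phaseLift S q.1 + q.2) ?_ ?_ (Set.toFinite _)
  · rintro ⟨v, h⟩ ⟨hv, hh⟩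
    refine hB _ fun χ hχ => ?_
    rw [harg v hv h hh ⟨χ, hχ⟩, ← Real.norm_eq_abs]
    exact (norm_le_pi_norm v _).trans (hT v hv).2
  · rintro ⟨v, h⟩ ⟨hv, hh⟩ ⟨v', h'⟩ ⟨hv', hh'⟩ he
    simp only at he hv hh hv' hh'
    have hvv : v = v' := by
      funext χ
      rw [← harg v hv h hh χ, he, harg v' hv' h' hh' χ]
    subst hvv
    simpa using he

theorem prod_mul_card_commonKernel_le [Finite G] [Fintype S] (B : Finset G)
    (hB : ∀ x, (∀ χ ∈ S, |(χ x).arg| ≤ 1) → x ∈ B) {r : ℕ} (v : Fin r → S → ℝ)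
    (hv : ∀ i, v i ∈ phaseLattice S) (hind : ∀ m : Fin r → ℤ, ∑ i, m i • v i = 0 → m = 0)
    (N : Fin r → ℕ) (hN : ∑ i, N i * ‖v i‖ ≤ 1) :
    (∏ i, (2 * N i + 1)) * Nat.card (commonKernel S) ≤ B.card := by
  classical
  rw [← card_coeffBox, ← Finset.card_image_of_injective (coeffBox N)
    (f := fun m : Fin r → ℤ => ∑ i, m i • v i)]
  · refine card_mul_card_commonKernel_le B hB _ fun w hw => ?_
    obtain ⟨m, hm, rfl⟩ := Finset.mem_image.1 hw
    refine ⟨sum_mem fun i _ => zsmul_mem (hv i) _, le_trans ?_ hN⟩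
    refine norm_sum_le_of_le _ fun i _ => ?_
    rw [← Int.cast_smul_eq_zsmul ℝ, norm_smul, Real.norm_eq_abs]
    refine mul_le_mul_of_nonneg_right ?_ (norm_nonneg _)
    exact_mod_cast mem_coeffBox.1 hm i
  · intro m m' h
    have := hind (m - m') (by
      simp only at h
      simp only [Pi.sub_apply, sub_smul, Finset.sum_sub_distrib]
      rw [h, sub_self])
    exact sub_eq_zero.1 this

end Lift

section Structure

open Pointwise

/-- A set of elements with small phases at the characters in `S` is contained in a proper
symmetric coset-progression of bounded rank, whose dilates fit in the Bohr set of `S`. -/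
theorem exists_cosetProgression_of_phases (d : ℕ) : ∃ C : ℝ, 1 ≤ C ∧
    ∀ (G : Type) [AddCommGroup G] [Fintype G] (S : Set (AddChar G ℂ)) (B : Finset G),
      (∀ x, (∀ χ ∈ S, |(χ x).arg| ≤ 1) → x ∈ B) →
      ∀ (X : Set G) (R : ℝ), 0 < R → (∀ x ∈ X, ∀ χ ∈ S, |(χ x).arg| ≤ R) → C * R ≤ 1 →
      (∃ M : ℕ, (d + 1) * (M * R) ≤ 1 ∧ B.card < M ^ (d + 1)) →
      ∃ r ≤ d, ∃ (H : AddSubgroup G) (P : GAPData G r),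
        P.IsSymmetric ∧ IsProperCosetProg H P ∧ X ⊆ (H : Set G) + P.toSet ∧
        ∀ M : ℕ, C * (M * R) ≤ 1 →
          ((H : Set G) + P.toSet).ncard * M ^ r ≤ 3 ^ r * B.card := by
  obtain ⟨C₀, hC₀, hprog⟩ := exists_progression_of_discrete d
  have hd : (0 : ℝ) ≤ d := d.cast_nonneg
  refine ⟨(d + 1) * C₀, by nlinarith, ?_⟩
  intro G _ _ S B hB X R hR hX hCR ⟨M₀, hM₀, hBM₀⟩
  have : Fintype S := Fintype.ofFinite S
  have hphase : ∀ x ∈ X, ‖phase S x‖ ≤ R := fun x hx =>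
    (pi_norm_le_iff_of_nonneg hR.le).2 fun χ => hX x hx χ χ.2
  let W : Submodule ℝ (S → ℝ) := Submodule.span ℝ (phase S '' X)
  have hrank : Module.finrank ℝ W ≤ d := by
    by_contra! hlt
    obtain ⟨f, hf, -, hfi⟩ := Submodule.exists_fun_fin_finrank_span_eq ℝ (phase S '' X)
    have hui := hfi.comp (Fin.castLE (Nat.succ_le_of_lt hlt)) (Fin.castLE_injective _)
    have hmain := prod_mul_card_commonKernel_le B hB (f ∘ Fin.castLE (Nat.succ_le_of_lt hlt))
      (fun i => by
        obtain ⟨x, -, hx⟩ := hf (Fin.castLE (Nat.succ_le_of_lt hlt) i)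
        rw [Function.comp_apply, ← hx]
        exact phase_mem_phaseLattice x)
      (fun m hm => by
        funext i
        have := Fintype.linearIndependent_iff.1 hui (fun i => (m i : ℝ))
          (by simpa only [Int.cast_smul_eq_zsmul] using hm) i
        exact_mod_cast this)
      (fun _ => M₀) (by
        refine le_trans (Finset.sum_le_card_nsmul _ _ (M₀ * R) fun i _ => ?_) ?_
        · obtain ⟨x, hx, hxi⟩ := hf (Fin.castLE (Nat.succ_le_of_lt hlt) i)
          rw [Function.comp_apply, ← hxi]
          exact mul_le_mul_of_nonneg_left (hphase x hx) (Nat.cast_nonneg _)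
        · simpa using hM₀)
    rw [Finset.prod_const, Finset.card_univ, Fintype.card_fin] at hmain
    have h1 : M₀ ^ (d + 1) ≤ (2 * M₀ + 1) ^ (d + 1) := Nat.pow_le_pow_left (by omega) _
    have h2 : 0 < Nat.card (commonKernel S) := Nat.card_pos
    have h3 : (2 * M₀ + 1) ^ (d + 1) ≤ (2 * M₀ + 1) ^ (d + 1) * Nat.card (commonKernel S) :=
      Nat.le_mul_of_pos_right _ h2
    exact absurd hBM₀ (by simpa using h1.trans (h3.trans hmain))
  obtain ⟨r, hr, v, N, hv, hind, hcover⟩ := hprog W hrank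
    ((phaseLattice S).comap W.subtype.toAddMonoidHom) (fun ρ => by
      refine Set.Finite.of_finite_image (f := ((↑) : W → S → ℝ))
        ((finite_phaseLattice_ball ρ).subset ?_) Subtype.val_injective.injOn
      rintro _ ⟨w, ⟨hw, hwρ⟩, rfl⟩
      exact ⟨hw, hwρ⟩) R hR
  have hv' : ∀ i, (v i : S → ℝ) ∈ phaseLattice S := fun i => (hv i).1
  have hcoe : ∀ m : Fin r → ℤ,
      ∑ i, m i • (v i : S → ℝ) = ((∑ i, m i • v i : W) : S → ℝ) := by
    intro m
    simp
  have hind' : ∀ m : Fin r → ℤ, ∑ i, m i • (v i : S → ℝ) = 0 → m = 0 := by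
    intro m hm
    refine hind m (Subtype.ext ?_)
    rw [← hcoe, hm]
    rfl
  have hsize : ∑ i, N i * ‖(v i : S → ℝ)‖ ≤ (d + 1) * C₀ * R := by
    refine le_trans (Finset.sum_le_card_nsmul _ _ (C₀ * R) fun i _ => (hv i).2.2) ?_
    rw [Finset.card_univ, Fintype.card_fin, nsmul_eq_mul, mul_assoc]
    have : (r : ℝ) ≤ d := by exact_mod_cast hr
    exact mul_le_mul_of_nonneg_right (by linarith) (by positivity)
  obtain ⟨hsym, hproper, hcard⟩ := symmGAP_properties (commonKernel S)
    (fun i => phaseLift S (v i : S → ℝ)) N (by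
      intro m hm m' hm' h
      have hm := mem_coeffBox.1 hm
      have hm' := mem_coeffBox.1 hm'
      have hdiff : ∑ i, m i • phaseLift S (v i : S → ℝ) -
          ∑ i, m' i • phaseLift S (v i : S → ℝ) =
          ∑ i, (m - m') i • phaseLift S (v i : S → ℝ) := by
        simp only [Pi.sub_apply, sub_smul, Finset.sum_sub_distrib]
      rw [hdiff] at h
      refine sub_eq_zero.1 (hind' _ (funext fun χ => ?_))
      have h1 := h χ χ.2
      rw [apply_sum_phaseLift hv'] at h1
      have h2 : |(∑ i, (m - m') i • (v i : S → ℝ)) χ| ≤ 2 := by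
        rw [← Real.norm_eq_abs]
        refine (norm_le_pi_norm _ χ).trans ?_
        suffices hb : ‖∑ i, (m - m') i • (v i : S → ℝ)‖ ≤ ∑ i, 2 * (N i * ‖(v i : S → ℝ)‖) by
          refine hb.trans ?_
          rw [← Finset.mul_sum]
          linarith
        refine norm_sum_le_of_le _ fun i _ => ?_
        rw [← Int.cast_smul_eq_zsmul ℝ, norm_smul, Real.norm_eq_abs, ← mul_assoc]
        refine mul_le_mul_of_nonneg_right ?_ (norm_nonneg _)
        have h3 : |(m - m') i| ≤ 2 * N i := by
          have := abs_sub (m i) (m' i)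
          have := hm i
          have := hm' i
          rw [Pi.sub_apply]
          omega
        exact_mod_cast h3
      rw [← arg_exp_mul_I_of_abs_le_two h2, h1, Complex.arg_one]
      rfl)
  refine ⟨r, hr, commonKernel S, _, hsym, hproper, ?_, ?_⟩
  · intro x hx
    obtain ⟨m, hm, hxm⟩ := hcover ⟨phase S x, Submodule.subset_span ⟨x, hx, rfl⟩⟩
      (phase_mem_phaseLattice x) (hphase x hx)
    refine ⟨x - ∑ i, m i • phaseLift S (v i : S → ℝ), ?_, ∑ i, m i • phaseLift S (v i : S → ℝ),
      ?_, sub_add_cancel _ _⟩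
    · intro χ hχ
      have hxm' : phase S x = ∑ i, m i • (v i : S → ℝ) := by
        rw [hcoe, ← hxm]
      rw [AddChar.map_sub_eq_div, apply_sum_phaseLift hv' m ⟨χ, hχ⟩, ← hxm']
      have : Complex.exp ((phase S x ⟨χ, hχ⟩ : ℝ) * Complex.I) = χ x :=
        exp_arg_mul_I_of_norm_one (AddChar.norm_apply _ x)
      rw [this, div_self]
      rw [← norm_ne_zero_iff, AddChar.norm_apply]
      exact one_ne_zero
    · rw [symmGAP_toSet]
      exact ⟨m, mem_coeffBox.2 hm, rfl⟩
  · intro M hM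
    have hmain := prod_mul_card_commonKernel_le B hB (fun i => (v i : S → ℝ)) hv' hind'
      (fun i => M * N i) (by
        have : ∑ i, ((M * N i : ℕ) : ℝ) * ‖(v i : S → ℝ)‖ =
            M * ∑ i, N i * ‖(v i : S → ℝ)‖ := by
          rw [Finset.mul_sum]
          exact Finset.sum_congr rfl fun i _ => by push_cast; ring
        rw [this]
        refine le_trans (mul_le_mul_of_nonneg_left hsize (Nat.cast_nonneg _)) ?_
        linarith)
    have hprod : (∏ i, (2 * N i + 1)) * M ^ r ≤ 3 ^ r * ∏ i, (2 * (M * N i) + 1) := by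
      have : ∀ c : ℕ, c ^ r = ∏ _i : Fin r, c := fun c => by simp
      rw [this, this, ← Finset.prod_mul_distrib, ← Finset.prod_mul_distrib]
      refine Finset.prod_le_prod' fun i _ => ?_
      have := Nat.mul_le_mul_left M (hv i).2.1
      nlinarith
    rw [hcard]
    calc Nat.card (commonKernel S) * (∏ i, (2 * N i + 1)) * M ^ r
        = Nat.card (commonKernel S) * ((∏ i, (2 * N i + 1)) * M ^ r) := by ring
      _ ≤ Nat.card (commonKernel S) * (3 ^ r * ∏ i, (2 * (M * N i) + 1)) :=
        Nat.mul_le_mul_left _ hprod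
      _ = 3 ^ r * ((∏ i, (2 * (M * N i) + 1)) * Nat.card (commonKernel S)) := by ring
      _ ≤ 3 ^ r * B.card := Nat.mul_le_mul_left _ hmain

end Structure

section LongRange

open Pointwise

theorem half_le_natFloor {t : ℝ} (ht : 1 ≤ t) : t / 2 ≤ ⌊t⌋₊ := by
  have h1 := Nat.lt_floor_add_one t
  have h2 : (1 : ℝ) ≤ ⌊t⌋₊ := by exact_mod_cast Nat.one_le_floor_iff t |>.2 ht
  linarith

/-- A function bounded by `l ^ D` at `l` has a scale above `√l` at which it does not grow fast. -/
theorem exists_slow_growth_scale (f : ℝ → ℝ) (hf : ∀ t, 0 < t → 1 ≤ f t) {D : ℕ} (hD : 1 ≤ D)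
    {l : ℝ} (hl : 1 ≤ l) (hfl : f l ≤ l ^ D) :
    ∃ q : ℝ, 1 ≤ q ∧ q ^ 2 ≤ l ∧ q ^ (2 * D + 1) * f (l / q) ≤ f l ∧
      f (l / q) ≤ 8 ^ (2 * D + 1) * f (l / q / 8) := by
  have hl0 : 0 < l := by linarith
  have hchain : ∀ i : ℕ, (∀ j < i, ¬ f (l / 8 ^ j) ≤ 8 ^ (2 * D + 1) * f (l / 8 ^ j / 8)) →
      ((8 : ℝ) ^ i) ^ (2 * D + 1) * f (l / 8 ^ i) ≤ f l := by
    intro i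
    induction i with
    | zero => intro; simp
    | succ i ih =>
      intro h
      have h1 := ih fun j hj => h j (by omega)
      have h2 := not_le.1 (h i (by omega))
      have h3 : l / (8 : ℝ) ^ (i + 1) = l / 8 ^ i / 8 := by rw [pow_succ, div_div]
      rw [h3, pow_succ (8 : ℝ) i, mul_pow, mul_assoc]
      exact (mul_le_mul_of_nonneg_left h2.le (by positivity)).trans h1
  have hex : ∃ i : ℕ, f (l / 8 ^ i) ≤ 8 ^ (2 * D + 1) * f (l / 8 ^ i / 8) := by
    by_contra! hcon
    obtain ⟨i, hi⟩ := pow_unbounded_of_one_lt (f l) (by norm_num : (1 : ℝ) < 8)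
    have h1 := hchain i fun j _ => not_le.2 (hcon j)
    have h2 : (8 : ℝ) ^ i ≤ (8 ^ i) ^ (2 * D + 1) :=
      le_self_pow₀ (one_le_pow₀ (by norm_num)) (by omega)
    have h3 := hf (l / 8 ^ i) (by positivity)
    nlinarith [pow_pos (by norm_num : (0 : ℝ) < 8) i]
  classical
  have hq1 : (1 : ℝ) ≤ 8 ^ Nat.find hex := one_le_pow₀ (by norm_num)
  have hmain := hchain (Nat.find hex) fun j hj => Nat.find_min hex hj
  refine ⟨8 ^ Nat.find hex, hq1, ?_, hmain, Nat.find_spec hex⟩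
  set q : ℝ := 8 ^ Nat.find hex
  have h1 : (q ^ 2) ^ D ≤ l ^ D := by
    rw [← pow_mul]
    have h2 : q ^ (2 * D) ≤ q ^ (2 * D + 1) := pow_le_pow_right₀ hq1 (by omega)
    have h3 := hf (l / q) (by positivity)
    have h4 : 0 < q ^ (2 * D + 1) := by positivity
    nlinarith
  exact (pow_le_pow_iff_left₀ (by positivity) hl0.le (by omega)).1 h1

/-- If the ball of radius `l` of a seminorm has size polynomial in `l`, then its unit ball is
contained in a proper coset-progression of bounded rank `r`, smaller by a factor `l ^ r`. -/
theorem exists_cosetProgression_of_card_finBall_le (D : ℕ) (hD : 1 ≤ D) :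
    ∃ C l₀ : ℝ, 1 ≤ C ∧ 1 ≤ l₀ ∧
      ∀ (G : Type) [AddCommGroup G] [Fintype G] (p : AddGroupSeminorm G) (l : ℝ), l₀ ≤ l →
      ((p.finBall l).card : ℝ) ≤ l ^ D →
      ∃ r ≤ 2 * D, ∃ (H : AddSubgroup G) (P : GAPData G r),
        P.IsSymmetric ∧ IsProperCosetProg H P ∧ {x | p x ≤ 1} ⊆ (H : Set G) + P.toSet ∧
        (((H : Set G) + P.toSet).ncard : ℝ) * l ^ r ≤ C * (p.finBall l).card := by
  obtain ⟨δ, hδ, hsand⟩ := exists_bohr_sandwich (8 ^ (2 * D + 1)) (one_le_pow₀ (by norm_num))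
  obtain ⟨C₁, hC₁, hstr⟩ := exists_cosetProgression_of_phases (2 * D)
  have hC₁0 : 0 < C₁ := by linarith
  set c : ℝ := δ / (8 * C₁) with hc
  have hc0 : 0 < c := by positivity
  set c' : ℝ := δ / (8 * (2 * D + 1)) with hc'
  have hc'0 : 0 < c' := by positivity
  set s₀ : ℝ := 1 + 4 * C₁ / δ + 4 * (2 * D + 1) / δ + 64 ^ D / c' ^ (2 * D + 1) with hs₀
  have ha : 0 < 4 * C₁ / δ := by positivity
  have hb : 0 < 4 * (2 * D + 1) / δ := by positivity
  have hd : 0 < 64 ^ D / c' ^ (2 * D + 1) := by positivity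
  have hs₀1 : 1 ≤ s₀ := by linarith
  refine ⟨(1 + 24 / c) ^ (2 * D), 64 * s₀ ^ 2, one_le_pow₀ (by
    have : 0 < 24 / c := by positivity
    linarith), by nlinarith, ?_⟩
  intro G _ _ p l hl hcard
  have hl1 : 1 ≤ l := by nlinarith
  obtain ⟨q, hq1, hql, hqf, hslow⟩ := exists_slow_growth_scale
    (fun t => ((p.finBall t).card : ℝ))
    (fun t ht => by exact_mod_cast Nat.one_le_iff_ne_zero.2 (p.card_finBall_pos ht.le).ne') hD hl1
    hcard
  have hq0 : 0 < q := by linarith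
  set s : ℝ := l / q / 8 with hs
  have hlq : l / q = 8 * s := by rw [hs]; ring
  have hls : l = 8 * s * q := by rw [← hlq]; field_simp
  have hs0 : 0 < s := by positivity
  have hs2 : l / 64 ≤ s ^ 2 := by
    have : 64 * s ^ 2 * q ^ 2 = l * l := by rw [hls]; ring
    by_contra! hlt
    nlinarith [sq_nonneg s]
  have hss : s₀ ≤ s := by
    refine le_of_sq_le_sq ?_ hs0.le
    linarith
  rw [hlq] at hqf hslow
  obtain ⟨S, hS1, hS2⟩ := hsand G p s hs0 hslow
  have hδs1 : 4 * C₁ ≤ δ * s := by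
    have : 4 * C₁ / δ ≤ s := by linarith
    rw [div_le_iff₀ hδ] at this
    linarith
  have hδs2 : 4 * (2 * D + 1) ≤ δ * s := by
    have : 4 * (2 * D + 1) / δ ≤ s := by linarith
    rw [div_le_iff₀ hδ] at this
    linarith
  have hδs : 0 < δ * s := by positivity
  set R : ℝ := 4 / (δ * s) with hR
  have hR0 : 0 < R := by positivity
  have hBl : ((p.finBall (8 * s)).card : ℝ) ≤ l ^ D := by
    refine (p.card_finBall_mono ?_).trans hcard
    rw [hls]
    nlinarith
  obtain ⟨r, hr, H, P, hsym, hprop, hsub, hsize⟩ := hstr G S (p.finBall (8 * s))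
    (fun x hx => AddGroupSeminorm.mem_finBall.2 (hS1 x hx)) {x | p x ≤ 1} R hR0
    (fun x hx χ hχ => by
      have h1 := hS2 x hx χ hχ ⌊δ * s⌋₊ (Nat.floor_le hδs.le)
      have h2 := half_le_natFloor (t := δ * s) (by linarith)
      rw [hR, le_div_iff₀ hδs]
      nlinarith [abs_nonneg (χ x).arg])
    (by rw [hR, mul_div_assoc', div_le_one hδs]; linarith)
    (by
      have h1 : 1 ≤ δ * s / (4 * (2 * D + 1)) := by
        rwa [le_div_iff₀ (by positivity), one_mul]
      refine ⟨⌊δ * s / (4 * (2 * D + 1))⌋₊, ?_, ?_⟩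
      · have h2 := Nat.floor_le (zero_le_one.trans h1)
        rw [hR, mul_div_assoc', mul_div_assoc', div_le_one hδs]
        rw [le_div_iff₀ (by positivity)] at h2
        push_cast
        linarith
      · have h2 := half_le_natFloor h1
        have h3 : c' * s ≤ ⌊δ * s / (4 * (2 * D + 1))⌋₊ := by
          refine le_trans (le_of_eq ?_) h2
          rw [hc']
          field_simp
          norm_num
        have h4 : (64 : ℝ) ^ D < c' ^ (2 * D + 1) * s := by
          have : 64 ^ D / c' ^ (2 * D + 1) < s := by linarith
          rw [div_lt_iff₀ (by positivity)] at this
          linarith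
        have h5 : l ^ D < (c' * s) ^ (2 * D + 1) := by
          have h6 : (l / 64) ^ D ≤ (s ^ 2) ^ D := pow_le_pow_left₀ (by positivity) hs2 _
          have h7 : l ^ D = 64 ^ D * (l / 64) ^ D := by rw [← mul_pow]; congr 1; ring
          have h8 : (c' * s) ^ (2 * D + 1) = c' ^ (2 * D + 1) * s * (s ^ 2) ^ D := by
            rw [mul_pow, ← pow_mul, pow_succ s]
            ring
          rw [h7, h8]
          exact (mul_le_mul_of_nonneg_left h6 (by positivity)).trans_lt
            (mul_lt_mul_of_pos_right h4 (by positivity))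
        have h6 := hBl.trans_lt (h5.trans_le (pow_le_pow_left₀ (by positivity) h3 _))
        exact_mod_cast h6)
  refine ⟨r, hr, H, P, hsym, hprop, hsub, ?_⟩
  have h1 : 1 ≤ δ * s / (4 * C₁) := by
    rwa [le_div_iff₀ (by positivity), one_mul]
  have h2 := half_le_natFloor h1
  have h3 : c * s ≤ ⌊δ * s / (4 * C₁)⌋₊ := by
    refine le_trans (le_of_eq ?_) h2
    rw [hc]
    field_simp
    norm_num
  have h4 := hsize ⌊δ * s / (4 * C₁)⌋₊ (by
    have h5 := Nat.floor_le (zero_le_one.trans h1)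
    rw [hR, mul_div_assoc', mul_div_assoc', div_le_one hδs]
    rw [le_div_iff₀ (by positivity)] at h5
    linarith)
  have h5 : (((H : Set G) + P.toSet).ncard : ℝ) * (c * s) ^ r ≤
      3 ^ r * (p.finBall (8 * s)).card := by
    have h6 : (((H : Set G) + P.toSet).ncard : ℝ) * (⌊δ * s / (4 * C₁)⌋₊ : ℝ) ^ r ≤
        3 ^ r * (p.finBall (8 * s)).card := by exact_mod_cast h4
    exact (mul_le_mul_of_nonneg_left (pow_le_pow_left₀ (by positivity) h3 _)
      (Nat.cast_nonneg _)).trans h6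
  calc (((H : Set G) + P.toSet).ncard : ℝ) * l ^ r
      = (((H : Set G) + P.toSet).ncard : ℝ) * (c * s) ^ r * ((8 / c) ^ r * q ^ r) := by
        rw [mul_assoc, ← mul_pow, ← mul_pow, hls]
        congr 2
        field_simp
    _ ≤ 3 ^ r * (p.finBall (8 * s)).card * ((8 / c) ^ r * q ^ r) :=
        mul_le_mul_of_nonneg_right h5 (by positivity)
    _ = (24 / c) ^ r * (q ^ r * (p.finBall (8 * s)).card) := by
        rw [show 24 / c = 3 * (8 / c) by ring, mul_pow]
        ring
    _ ≤ (1 + 24 / c) ^ (2 * D) * (p.finBall l).card := by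
        have h24 : 0 < 24 / c := by positivity
        refine mul_le_mul ?_ ?_ (mul_nonneg (pow_nonneg hq0.le _) (Nat.cast_nonneg _))
          (by positivity)
        · exact (pow_le_pow_left₀ h24.le (by linarith) _).trans
            (pow_le_pow_right₀ (by linarith) hr)
        · exact (mul_le_mul_of_nonneg_right (pow_le_pow_right₀ hq1 (by omega))
            (Nat.cast_nonneg _)).trans hqf

end LongRange

section Walk

theorem lazyProb_nonneg {G : Type*} [AddCommGroup G] [DecidableEq G] {n : ℕ} (A : Fin n → G)
    {α : ℝ} (hα0 : 0 ≤ α) (hα1 : α ≤ 1) (a : G) : 0 ≤ lazyProb A α a := by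
  refine Finset.sum_nonneg fun x _ => mul_nonneg (Finset.prod_nonneg fun i _ => ?_) ?_
  · generalize x i = k
    fin_cases k <;> simp <;> linarith
  · split_ifs <;> norm_num

theorem AddChar.re_apply_neg {G : Type*} [AddCommGroup G] [Finite G] (χ : AddChar G ℂ) (x : G) :
    (χ (-x)).re = (χ x).re := by
  rw [AddChar.map_neg_eq_conj, Complex.conj_re]

theorem AddChar.normSq_one_sub_apply {G : Type*} [AddCommGroup G] [Finite G] (χ : AddChar G ℂ)
    (x : G) : ‖1 - χ x‖ ^ 2 = 2 * (1 - (χ x).re) := by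
  have h := AddChar.norm_apply χ x
  have h2 : (χ x).re * (χ x).re + (χ x).im * (χ x).im = 1 := by
    rw [← Complex.normSq_apply, ← Complex.sq_norm, h, one_pow]
  rw [Complex.sq_norm, Complex.normSq_apply]
  simp only [Complex.sub_re, Complex.one_re, Complex.sub_im, Complex.one_im]
  nlinarith

theorem AddChar.re_apply_add_self {G : Type*} [AddCommGroup G] [Finite G] (χ : AddChar G ℂ)
    (x : G) : (χ (x + x)).re = 2 * (χ x).re ^ 2 - 1 := by
  have h2 : (χ x).re * (χ x).re + (χ x).im * (χ x).im = 1 := by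
    rw [← Complex.normSq_apply, ← Complex.sq_norm, AddChar.norm_apply χ x, one_pow]
  rw [AddChar.map_add_eq_mul, Complex.mul_re]
  nlinarith

theorem AddChar.re_apply_le_one {G : Type*} [AddCommGroup G] [Finite G] (χ : AddChar G ℂ)
    (x : G) : (χ x).re ≤ 1 :=
  (Complex.re_le_norm _).trans (AddChar.norm_apply χ x).le

/-- Fourier inversion for the lazy random walk. -/
theorem card_mul_lazyProb {G : Type*} [AddCommGroup G] [Fintype G] [DecidableEq G] {n : ℕ}
    (A : Fin n → G) (α : ℝ) (a : G) :
    ((Fintype.card G * lazyProb A α a : ℝ) : ℂ) =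
      ∑ χ : AddChar G ℂ, χ (-a) * ∏ i, ((1 - α + α * (χ (A i)).re : ℝ) : ℂ) := by
  have hstep : ∀ (χ : AddChar G ℂ) (y : G), ((1 - α + α * (χ y).re : ℝ) : ℂ) =
      ∑ k : Fin 3, ((![α / 2, 1 - α, α / 2] k : ℝ) : ℂ) * χ (![(-1 : ℤ), 0, 1] k • y) := by
    intro χ y
    have h1 : (((χ y).re : ℝ) : ℂ) = (χ y + χ (-y)) / 2 := by
      rw [AddChar.map_neg_eq_conj, Complex.add_conj]
      push_cast
      ring
    rw [Fin.sum_univ_three]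
    simp only [Matrix.cons_val_zero, Matrix.cons_val_one, Matrix.cons_val, neg_smul, one_smul,
      zero_smul, AddChar.map_zero_eq_one]
    push_cast
    rw [h1]
    ring
  have hprod : ∀ χ : AddChar G ℂ, χ (-a) * ∏ i, ((1 - α + α * (χ (A i)).re : ℝ) : ℂ) =
      ∑ x : Fin n → Fin 3, ((∏ i, ![α / 2, 1 - α, α / 2] (x i) : ℝ) : ℂ) *
        χ (∑ i, ![(-1 : ℤ), 0, 1] (x i) • A i - a) := by
    intro χ
    simp_rw [hstep]
    rw [Finset.prod_univ_sum, Fintype.piFinset_univ, Finset.mul_sum]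
    refine Finset.sum_congr rfl fun x _ => ?_
    rw [Finset.prod_mul_distrib, ← AddChar.apply_finset_sum, Complex.ofReal_prod, sub_eq_add_neg _ a,
      AddChar.map_add_eq_mul]
    ring
  simp_rw [hprod]
  rw [Finset.sum_comm, lazyProb]
  push_cast
  rw [Finset.mul_sum]
  refine Finset.sum_congr rfl fun x _ => ?_
  rw [← Finset.mul_sum, AddChar.sum_apply_eq_ite]
  simp only [sub_eq_zero]
  split_ifs
  · simp
    ring
  · simp

theorem abs_lazy_factor_le {α c : ℝ} (hα0 : 1 / 2 ≤ α) (hα1 : α ≤ 1) (hc : |c| ≤ 1) :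
    |1 - α + α * c| ≤ Real.exp (-((1 - (2 * c ^ 2 - 1)) / 8)) := by
  obtain ⟨h1, h2⟩ := abs_le.1 hc
  have h3 := Real.add_one_le_exp (-((1 - (2 * c ^ 2 - 1)) / 8))
  refine le_trans (abs_le.2 ⟨?_, ?_⟩) h3
  · nlinarith [mul_nonneg (by linarith : 0 ≤ 1 - α) (by linarith : 0 ≤ 1 - c)]
  · nlinarith [mul_nonneg (by linarith : 0 ≤ α - 1 / 2) (by linarith : 0 ≤ 1 - c)]

theorem card_mul_lazyProb_le {G : Type*} [AddCommGroup G] [Fintype G] [DecidableEq G] {n : ℕ}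
    (A : Fin n → G) {α : ℝ} (hα0 : 1 / 2 ≤ α) (hα1 : α ≤ 1) (a : G) :
    Fintype.card G * lazyProb A α a ≤
      ∑ χ : AddChar G ℂ, Real.exp (-((∑ i, (1 - (χ (A i + A i)).re)) / 8)) := by
  have h1 := congrArg norm (card_mul_lazyProb A α a)
  rw [Complex.norm_real, Real.norm_eq_abs] at h1
  refine (le_abs_self _).trans (h1.le.trans (norm_sum_le_of_le _ fun χ _ => ?_))
  rw [norm_mul, AddChar.norm_apply, one_mul, norm_prod, Finset.sum_div, ← Finset.sum_neg_distrib,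
    Real.exp_sum]
  refine Finset.prod_le_prod (fun i _ => norm_nonneg _) fun i _ => ?_
  rw [Complex.norm_real, Real.norm_eq_abs, AddChar.re_apply_add_self]
  exact abs_lazy_factor_le hα0 hα1
    ((Complex.abs_re_le_norm _).trans (AddChar.norm_apply χ (A i)).le)

/-- The supremum defining `lazyRho` is at most the largest probability, unless it is trivial. -/
theorem exists_lazyRho_le_lazyProb {G : Type*} [AddCommGroup G] [Fintype G] [DecidableEq G] {n : ℕ}
    (A : Fin n → G) {α : ℝ} (hα0 : 0 ≤ α) (hα1 : α ≤ 1)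
    (h : 1 / (Fintype.card G : ℝ) < lazyRho A α) : ∃ a, lazyRho A α ≤ lazyProb A α a := by
  obtain ⟨a, ha⟩ := exists_eq_ciSup_of_finite
    (f := fun a : G => |lazyProb A α a - 1 / (Fintype.card G : ℝ)|)
  refine ⟨a, ?_⟩
  have ha' : |lazyProb A α a - 1 / (Fintype.card G : ℝ)| = lazyRho A α := ha
  have h0 := lazyProb_nonneg A hα0 hα1 a
  have h1 : (0 : ℝ) ≤ 1 / (Fintype.card G : ℝ) := by positivity
  rw [← ha'] at h ⊢
  rcases abs_cases (lazyProb A α a - 1 / (Fintype.card G : ℝ)) with ⟨h2, -⟩ | ⟨h2, -⟩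
  · rw [h2]
    linarith
  · rw [h2] at h
    linarith

end Walk

section LevelSets

/-- Some sublevel set of `ψ` captures the size of an exponential sum, with an exponential gain. -/
theorem exists_large_sublevel : ∃ c : ℝ, 0 < c ∧ c ≤ 1 ∧
    ∀ (X : Type) [Fintype X] (ψ : X → ℝ), (∀ x, 0 ≤ ψ x) → ∀ t : ℝ, 0 < t →
      t ≤ ∑ x, Real.exp (-(ψ x / 8)) →
      ∃ (m : ℕ) (S : Finset X), 1 ≤ m ∧ (∀ x ∈ S, ψ x ≤ m) ∧
        c * t * Real.exp (m / 16) ≤ S.card := by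
  set y : ℝ := Real.exp (-(1 / 16)) with hy
  have hy0 : 0 < y := Real.exp_pos _
  have hy1 : y < 1 := by
    rw [hy, Real.exp_lt_one_iff]
    norm_num
  refine ⟨y * (1 - y), mul_pos hy0 (by linarith), by nlinarith, ?_⟩
  intro X _ ψ hψ t ht hsum
  classical
  by_contra! hcon
  let M : ℕ := ∑ x, (⌊ψ x⌋₊ + 1)
  have hM : ∀ x, ⌊ψ x⌋₊ ∈ Finset.range M := fun x => Finset.mem_range.2
    (Nat.lt_of_succ_le (Finset.single_le_sum (f := fun x => ⌊ψ x⌋₊ + 1)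
      (fun _ _ => Nat.zero_le _) (Finset.mem_univ x)))
  have hterm : ∀ k : ℕ, ∑ x with ⌊ψ x⌋₊ = k, Real.exp (-(ψ x / 8)) ≤ (1 - y) * t * y ^ k := by
    intro k
    have h1 := hcon (k + 1) (Finset.univ.filter fun x => ⌊ψ x⌋₊ = k) (by omega) (fun x hx => by
      have := (Nat.lt_floor_add_one (ψ x)).le
      rw [(Finset.mem_filter.1 hx).2] at this
      exact_mod_cast this)
    have h2 : ∀ x ∈ Finset.univ.filter fun x => ⌊ψ x⌋₊ = k,
        Real.exp (-(ψ x / 8)) ≤ Real.exp (-(k / 8)) := fun x hx => by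
      have := Nat.floor_le (hψ x)
      rw [(Finset.mem_filter.1 hx).2] at this
      exact Real.exp_le_exp.2 (by linarith)
    refine (Finset.sum_le_card_nsmul _ _ _ h2).trans ?_
    rw [nsmul_eq_mul]
    refine (mul_le_mul_of_nonneg_right h1.le (Real.exp_pos _).le).trans (le_of_eq ?_)
    rw [hy, ← Real.exp_nat_mul, ← hy]
    have h3 : Real.exp (((k + 1 : ℕ) : ℝ) / 16) * Real.exp (-(k / 8)) * y =
        Real.exp (k * -(1 / 16)) := by
      rw [hy, ← Real.exp_add, ← Real.exp_add]
      congr 1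
      push_cast
      ring
    rw [← h3]
    ring
  have h1 : ∑ x, Real.exp (-(ψ x / 8)) ≤ ∑ k ∈ Finset.range M, (1 - y) * t * y ^ k := by
    rw [← Finset.sum_fiberwise_of_maps_to (t := Finset.range M) (fun x _ => hM x)]
    exact Finset.sum_le_sum fun k _ => hterm k
  rw [← Finset.mul_sum] at h1
  have h2 := mul_neg_geom_sum y M
  have h3 : 0 < y ^ M := by positivity
  have h4 : (1 - y) * t * ∑ k ∈ Finset.range M, y ^ k = t * (1 - y ^ M) := by
    rw [← h2]
    ring
  nlinarith

end LevelSets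

section CharSeminorm

variable {G : Type*} [AddCommGroup G] [Finite G]

/-- The `ℓ²` distance from `1` of the values at `x` of the characters in `S`. -/
noncomputable def charSeminorm (S : Finset (AddChar G ℂ)) : AddGroupSeminorm G where
  toFun x := ‖(WithLp.toLp 2 fun χ : S => 1 - (χ : AddChar G ℂ) x : EuclideanSpace ℂ S)‖
  map_zero' := by
    simp only [AddChar.map_zero_eq_one, sub_self]
    exact norm_zero
  add_le' x y := by
    have h1 : (WithLp.toLp 2 fun χ : S => 1 - (χ : AddChar G ℂ) (x + y) : EuclideanSpace ℂ S) =
        (WithLp.toLp 2 fun χ : S => 1 - (χ : AddChar G ℂ) x : EuclideanSpace ℂ S) +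
        (WithLp.toLp 2 fun χ : S => (χ : AddChar G ℂ) x * (1 - (χ : AddChar G ℂ) y) :
          EuclideanSpace ℂ S) := by
      ext χ
      simp only [PiLp.add_apply, AddChar.map_add_eq_mul]
      ring
    have h2 : ‖(WithLp.toLp 2 fun χ : S => (χ : AddChar G ℂ) x * (1 - (χ : AddChar G ℂ) y) :
          EuclideanSpace ℂ S)‖ =
        ‖(WithLp.toLp 2 fun χ : S => 1 - (χ : AddChar G ℂ) y : EuclideanSpace ℂ S)‖ := by
      rw [EuclideanSpace.norm_eq, EuclideanSpace.norm_eq]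
      simp only [norm_mul, AddChar.norm_apply, one_mul]
    rw [h1, ← h2]
    exact norm_add_le _ _
  neg' x := by
    rw [EuclideanSpace.norm_eq, EuclideanSpace.norm_eq]
    simp only [AddChar.normSq_one_sub_apply, AddChar.re_apply_neg]

theorem charSeminorm_sq (S : Finset (AddChar G ℂ)) (x : G) :
    charSeminorm S x ^ 2 = 2 * ∑ χ ∈ S, (1 - (χ x).re) := by
  change ‖(WithLp.toLp 2 fun χ : S => 1 - (χ : AddChar G ℂ) x : EuclideanSpace ℂ S)‖ ^ 2 = _
  rw [EuclideanSpace.norm_sq_eq, Finset.mul_sum, ← Finset.sum_coe_sort S]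
  exact Finset.sum_congr rfl fun χ _ => AddChar.normSq_one_sub_apply _ x

end CharSeminorm

section CharBall

variable {G : Type*} [AddCommGroup G] [Fintype G]

theorem sum_norm_sq_sum_addChar (S : Finset (AddChar G ℂ)) :
    ∑ x, ‖∑ χ ∈ S, χ x‖ ^ 2 = Fintype.card G * (S.card : ℝ) := by
  classical
  have h : ((∑ x, ‖∑ χ ∈ S, χ x‖ ^ 2 : ℝ) : ℂ) = ((Fintype.card G * (S.card : ℝ) : ℝ) : ℂ) := by
    push_cast
    have h1 : ∀ x : G, (‖∑ χ ∈ S, χ x‖ : ℂ) ^ 2 = ∑ χ ∈ S, ∑ χ' ∈ S, (χ - χ') x := by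
      intro x
      rw [← Complex.mul_conj', map_sum, Finset.sum_mul_sum]
      refine Finset.sum_congr rfl fun χ _ => Finset.sum_congr rfl fun χ' _ => ?_
      rw [AddChar.sub_apply', ← AddChar.map_neg_eq_conj, AddChar.map_neg_eq_inv, div_eq_mul_inv]
    simp_rw [h1]
    rw [Finset.sum_comm]
    have h2 : ∀ χ ∈ S, ∑ x, ∑ χ' ∈ S, (χ - χ') x = Fintype.card G := by
      intro χ hχ
      rw [Finset.sum_comm]
      simp_rw [AddChar.sum_eq_ite, sub_eq_zero]
      rw [Finset.sum_ite_eq, if_pos hχ]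
    rw [Finset.sum_congr rfl h2, Finset.sum_const, nsmul_eq_mul, mul_comm]
  exact_mod_cast h

theorem card_mul_card_finBall_charSeminorm_le (S : Finset (AddChar G ℂ)) (T : Finset G)
    (hT : ∀ x ∈ T, charSeminorm S x ^ 2 ≤ S.card) (hS : S.Nonempty) :
    (S.card : ℝ) * T.card ≤ 4 * Fintype.card G := by
  have hS0 : (0 : ℝ) < S.card := by exact_mod_cast hS.card_pos
  have h1 : ∀ x ∈ T, (S.card : ℝ) ^ 2 / 4 ≤ ‖∑ χ ∈ S, χ x‖ ^ 2 := by
    intro x hx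
    have h2 := hT x hx
    rw [charSeminorm_sq, Finset.sum_sub_distrib, Finset.sum_const, nsmul_one] at h2
    have h3 : ∑ χ ∈ S, (χ x).re ≤ ‖∑ χ ∈ S, χ x‖ := by
      rw [← Complex.re_sum]
      exact Complex.re_le_norm _
    nlinarith
  have h2 : T.card • ((S.card : ℝ) ^ 2 / 4) ≤ Fintype.card G * (S.card : ℝ) := by
    rw [← sum_norm_sq_sum_addChar]
    exact (Finset.card_nsmul_le_sum _ _ _ h1).trans
      (Finset.sum_le_sum_of_subset_of_nonneg (Finset.subset_univ _) fun _ _ _ => sq_nonneg _)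
  rw [nsmul_eq_mul] at h2
  nlinarith

end CharBall

section LargeSublevel

open Pointwise

/-- If the `b i` have small total phase at each of at least `κ * #G` characters, then most of them
lie in a proper coset-progression of bounded rank and size. -/
theorem exists_cosetProgression_of_characters (D : ℕ) (hD : 1 ≤ D) :
    ∃ C l₀ : ℝ, 1 ≤ C ∧ 1 ≤ l₀ ∧
      ∀ (G : Type) [AddCommGroup G] [Fintype G] (n : ℕ) (b : Fin n → G)
        (S : Finset (AddChar G ℂ)) (m n' : ℕ) (κ l : ℝ), 1 ≤ m → 0 < n' → 0 < κ →
      (∀ χ ∈ S, ∑ i, (1 - (χ (b i)).re) ≤ m) → κ * Fintype.card G ≤ S.card →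
      l₀ ≤ l → l ^ 2 = n' / (2 * m) → 4 / κ ≤ l ^ D →
      ∃ r ≤ 2 * D, ∃ (H : AddSubgroup G) (P : GAPData G r),
        P.IsSymmetric ∧ IsProperCosetProg H P ∧
        n - n' ≤ {i : Fin n | b i ∈ (H : Set G) + P.toSet}.ncard ∧
        (((H : Set G) + P.toSet).ncard : ℝ) * l ^ r ≤ C * (4 / κ) := by
  obtain ⟨C, l₀, hC, hl₀, hmain⟩ := exists_cosetProgression_of_card_finBall_le D hD
  refine ⟨C, l₀, hC, hl₀, ?_⟩
  intro G _ _ n b S m n' κ l hm hn' hκ hS hκS hl hl2 hκl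
  have hm0 : (0 : ℝ) < m := by exact_mod_cast hm
  have hn0 : (0 : ℝ) < n' := by exact_mod_cast hn'
  have hG : (0 : ℝ) < Fintype.card G := by exact_mod_cast Fintype.card_pos
  have hS0 : (0 : ℝ) < S.card := lt_of_lt_of_le (by positivity) hκS
  have hSne : S.Nonempty := Finset.card_pos.1 (by exact_mod_cast hS0)
  have hl0 : 0 < l := by linarith
  set τ : ℝ := √(2 * m * S.card / n') with hτ
  have hτ2 : τ ^ 2 = 2 * m * S.card / n' := Real.sq_sqrt (by positivity)
  have hτ0 : 0 < τ := Real.sqrt_pos.2 (by positivity)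
  let p : AddGroupSeminorm G := τ⁻¹.toNNReal • charSeminorm S
  have hp : ∀ x, p x = τ⁻¹ * charSeminorm S x := fun x => by
    rw [smul_apply, NNReal.smul_def, Real.coe_toNNReal _ (by positivity),
      smul_eq_mul]
  have hpt : ∀ x t, p x ≤ t ↔ charSeminorm S x ≤ τ * t := by
    intro x t
    rw [hp, inv_mul_le_iff₀ hτ0]
  have hball : ((p.finBall l).card : ℝ) ≤ 4 / κ := by
    have h1 := card_mul_card_finBall_charSeminorm_le S (p.finBall l) (fun x hx => by
      have h2 := (hpt x l).1 (AddGroupSeminorm.mem_finBall.1 hx)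
      have h3 := pow_le_pow_left₀ (apply_nonneg (charSeminorm S) x) h2 2
      refine h3.trans (le_of_eq ?_)
      rw [mul_pow, hτ2, hl2]
      field_simp) hSne
    rw [le_div_iff₀ hκ]
    have h2 : κ * Fintype.card G * (p.finBall l).card ≤ 4 * Fintype.card G :=
      (mul_le_mul_of_nonneg_right hκS (Nat.cast_nonneg _)).trans h1
    nlinarith
  obtain ⟨r, hr, H, P, hsym, hprop, hsub, hsize⟩ := hmain G p l hl (hball.trans hκl)
  refine ⟨r, hr, H, P, hsym, hprop, ?_,
    hsize.trans (mul_le_mul_of_nonneg_left hball (by linarith))⟩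
  classical
  let bad : Finset (Fin n) := Finset.univ.filter fun i => ¬ p (b i) ≤ 1
  have hbad : bad.card ≤ n' := by
    have h1 : ∀ i ∈ bad, m * S.card / n' ≤ ∑ χ ∈ S, (1 - (χ (b i)).re) := by
      intro i hi
      have h2 : τ ≤ charSeminorm S (b i) := by
        have h3 := (Finset.mem_filter.1 hi).2
        rw [hpt, mul_one, not_le] at h3
        exact h3.le
      have h3 := pow_le_pow_left₀ hτ0.le h2 2
      rw [hτ2, charSeminorm_sq] at h3
      have h4 : 2 * (m * S.card / n') = 2 * m * S.card / (n' : ℝ) := by ring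
      linarith
    have h2 := Finset.card_nsmul_le_sum _ _ _ h1
    have h3 : ∑ i ∈ bad, ∑ χ ∈ S, (1 - (χ (b i)).re) ≤ ∑ i, ∑ χ ∈ S, (1 - (χ (b i)).re) :=
      Finset.sum_le_sum_of_subset_of_nonneg (Finset.subset_univ _) fun i _ _ =>
        Finset.sum_nonneg fun χ _ => sub_nonneg.2 (AddChar.re_apply_le_one χ _)
    rw [Finset.sum_comm (s := Finset.univ)] at h3
    have h4 := Finset.sum_le_card_nsmul _ _ _ hS
    rw [nsmul_eq_mul] at h2 h4
    have h5 : (bad.card : ℝ) * (m * S.card / n') ≤ S.card * m := h2.trans (h3.trans h4)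
    rw [mul_div_assoc', div_le_iff₀ hn0] at h5
    have h6 : (0 : ℝ) < m * S.card := by positivity
    have h7 : (bad.card : ℝ) ≤ n' := by nlinarith
    exact_mod_cast h7
  have hgood : Finset.univ.filter (fun i => p (b i) ≤ 1) ⊆
      (Set.toFinite {i : Fin n | b i ∈ (H : Set G) + P.toSet}).toFinset := by
    intro i hi
    exact (Set.Finite.mem_toFinset _).2 (hsub (Finset.mem_filter.1 hi).2)
  have h1 := Finset.card_le_card hgood
  rw [← Set.ncard_eq_toFinset_card] at h1
  have h2 := Finset.card_filter_add_card_filter_not (s := (Finset.univ : Finset (Fin n)))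
    (fun i => p (b i) ≤ 1)
  rw [Finset.card_univ, Fintype.card_fin] at h2
  change _ + bad.card = n at h2
  omega

end LargeSublevel

theorem pow_le_mul_exp (m k : ℕ) :
    (2 * m : ℝ) ^ k ≤ 32 ^ k * k.factorial * Real.exp (m / 16) := by
  have h1 := Real.pow_div_factorial_le_exp ((m : ℝ) / 16) (by positivity) k
  rw [div_le_iff₀ (by positivity)] at h1
  calc (2 * m : ℝ) ^ k = 32 ^ k * ((m : ℝ) / 16) ^ k := by rw [← mul_pow]; congr 1; ring
    _ ≤ 32 ^ k * (Real.exp (m / 16) * k.factorial) :=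
      mul_le_mul_of_nonneg_left h1 (by positivity)
    _ = _ := by ring

theorem eventually_scales (ε B a l₀ : ℝ) (hε : 0 < ε) :
    ∃ n₀ : ℕ, ∀ n : ℕ, n₀ ≤ n → (1 : ℝ) ≤ n ∧ a ≤ n ∧
      B * Real.log n ≤ (n : ℝ) ^ (ε / 2) ∧ l₀ ≤ (n : ℝ) ^ (ε / 4) := by
  have h : ∀ᶠ x : ℝ in Filter.atTop, 1 ≤ x ∧ a ≤ x ∧
      B * Real.log x ≤ x ^ (ε / 2) ∧ l₀ ≤ x ^ (ε / 4) := by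
    refine (Filter.eventually_ge_atTop 1).and ((Filter.eventually_ge_atTop a).and
      (Filter.Eventually.and ?_ ((tendsto_rpow_atTop (by linarith)).eventually_ge_atTop l₀)))
    have h1 := ((isLittleO_log_rpow_atTop (by linarith : 0 < ε / 2)).const_mul_left B).bound
      one_pos
    filter_upwards [h1, Filter.eventually_ge_atTop 1] with x hx hx1
    rw [one_mul, Real.norm_eq_abs, Real.norm_eq_abs, abs_of_nonneg
      (Real.rpow_nonneg (by linarith) _)] at hx
    exact (le_abs_self _).trans hx
  exact Filter.eventually_atTop.1 (tendsto_natCast_atTop_atTop.eventually h)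

theorem stmt1 (ε C : ℝ) (hε0 : 0 < ε) (hε : ε < 1 / 2) (hC : 0 < C) :
    ∃ (r₀ : ℕ) (K : ℝ) (n₀ : ℕ), ∀ n : ℕ, n₀ ≤ n →
      ∀ (G : Type) [AddCommGroup G] [Fintype G] [DecidableEq G],
        ∀ (A : Fin n → G) (α : ℝ),
          1 / 2 ≤ α → α ≤ 1 →
          (n : ℝ) ^ (-C) ≤ lazyRho A α →
          ∀ n' : ℕ, α⁻¹ * (n : ℝ) ^ ε ≤ (n' : ℝ) → n' ≤ n →
            ∃ (r : ℕ) (H : AddSubgroup G) (P : GAPData G r),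
              r ≤ r₀ ∧ P.IsSymmetric ∧ IsProperCosetProg H P ∧
              n - n' ≤ {i : Fin n | A i + A i ∈ (H : Set G) + P.toSet}.ncard ∧
              (((H : Set G) + P.toSet).ncard : ℝ) ≤
                max 1 (K * (lazyRho A α)⁻¹ / (n' : ℝ) ^ ((r : ℝ) / 2)) := by
  obtain ⟨c, hc0, hc1, hlevel⟩ := exists_large_sublevel
  have hDpos : 0 < 4 * (C + 1) / ε := by positivity
  obtain ⟨D, hD, hDε⟩ : ∃ D : ℕ, 1 ≤ D ∧ C + 1 ≤ ε / 4 * D := by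
    refine ⟨⌈4 * (C + 1) / ε⌉₊, Nat.one_le_ceil_iff.2 hDpos, ?_⟩
    have := Nat.le_ceil (4 * (C + 1) / ε)
    rw [div_le_iff₀ hε0] at this
    linarith
  obtain ⟨C₁, l₀, hC₁, hl₀, hstruct⟩ := exists_cosetProgression_of_characters D hD
  obtain ⟨n₀, hn₀⟩ := eventually_scales ε (32 * (C + 1)) (4 / c) l₀ hε0
  obtain ⟨F, hF1, hF⟩ : ∃ F : ℝ, 1 ≤ F ∧
      ∀ m : ℕ, (2 * m : ℝ) ^ (2 * D) ≤ F * Real.exp (m / 16) :=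
    ⟨_, one_le_mul_of_one_le_of_one_le (one_le_pow₀ (by norm_num))
      (by exact_mod_cast Nat.one_le_iff_ne_zero.2 (Nat.factorial_ne_zero _)),
      fun m => pow_le_mul_exp m (2 * D)⟩
  have hc4 : 1 ≤ 4 / c := by
    rw [le_div_iff₀ hc0]
    linarith
  refine ⟨2 * D, C₁ * (4 / c) * F, n₀, ?_⟩
  intro n hn G _ _ _ A α hα0 hα1 hρ n' hn'1 hn'2
  obtain ⟨hn1, hnc, hnlog, hnl⟩ := hn₀ n hn
  have hnpos : (0 : ℝ) < n := by linarith
  have hG : (0 : ℝ) < Fintype.card G := by exact_mod_cast Fintype.card_pos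
  set ρ : ℝ := lazyRho A α with hρdef
  have hρ0 : 0 < ρ := (Real.rpow_pos_of_pos hnpos _).trans_le hρ
  rcases le_or_gt ρ (1 / (Fintype.card G : ℝ)) with hsmall | hlarge
  · obtain ⟨hsym, hprop, hcard⟩ := symmGAP_properties (⊤ : AddSubgroup G) (r := 0) Fin.elim0
      Fin.elim0 (fun _ _ _ _ _ => Subsingleton.elim _ _)
    refine ⟨0, ⊤, _, Nat.zero_le _, hsym, hprop, ?_, le_max_of_le_right ?_⟩
    · have : {i : Fin n | A i + A i ∈ ((⊤ : AddSubgroup G) : Set G) +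
          (symmGAP (Fin.elim0 : Fin 0 → G) Fin.elim0).toSet} = Set.univ := by
        refine Set.eq_univ_of_forall fun i => ⟨A i + A i, trivial, 0, ?_, add_zero _⟩
        rw [symmGAP_toSet]
        exact ⟨0, mem_coeffBox.2 fun i => i.elim0, by simp⟩
      rw [this, Set.ncard_univ, Nat.card_eq_fintype_card, Fintype.card_fin]
      exact Nat.sub_le _ _
    · rw [hcard]
      have h1 : (Fintype.card G : ℝ) ≤ ρ⁻¹ := by
        rw [le_inv_comm₀ hG hρ0, ← one_div]
        exact hsmall
      have h2 : 1 ≤ C₁ * (4 / c) * F :=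
        one_le_mul_of_one_le_of_one_le (one_le_mul_of_one_le_of_one_le hC₁ hc4) hF1
      have h3 : 0 < ρ⁻¹ := by positivity
      simp only [AddSubgroup.card_top, Nat.card_eq_fintype_card, Finset.univ_eq_empty,
        Finset.prod_empty, mul_one, Nat.cast_zero, zero_div, Real.rpow_zero, div_one]
      nlinarith
  obtain ⟨a, ha⟩ := exists_lazyRho_le_lazyProb A (by linarith) hα1 hlarge
  obtain ⟨m, S, hm, hS, hScard⟩ := hlevel (AddChar G ℂ)
    (fun χ => ∑ i, (1 - (χ (A i + A i)).re))
    (fun χ => Finset.sum_nonneg fun i _ => sub_nonneg.2 (AddChar.re_apply_le_one χ _))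
    (Fintype.card G * ρ) (by positivity)
    ((mul_le_mul_of_nonneg_left ha hG.le).trans (card_mul_lazyProb_le A hα0 hα1 a))
  have hm0 : (0 : ℝ) < m := by exact_mod_cast hm
  set κ : ℝ := c * ρ * Real.exp (m / 16) with hκ
  have hκ0 : 0 < κ := by positivity
  have hexp1 : 1 ≤ Real.exp ((m : ℝ) / 16) := Real.one_le_exp (by positivity)
  have hρinv : ρ⁻¹ ≤ (n : ℝ) ^ C := by
    rw [inv_le_comm₀ hρ0 (by positivity), ← Real.rpow_neg hnpos.le]
    exact hρ
  have hκG : κ * Fintype.card G ≤ S.card := by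
    refine le_trans (le_of_eq ?_) hScard
    rw [hκ]
    ring
  have hκ1 : κ ≤ 1 := by
    have h1 : (S.card : ℝ) ≤ Fintype.card G := by
      have := Finset.card_le_univ S
      rw [← AddChar.card_eq (α := G)]
      exact_mod_cast this
    by_contra! h2
    nlinarith
  have hnC : 4 / c * (n : ℝ) ^ C ≤ (n : ℝ) ^ (C + 1) := by
    rw [Real.rpow_add hnpos, Real.rpow_one, mul_comm]
    exact mul_le_mul_of_nonneg_left hnc (by positivity)
  have hexp : Real.exp ((m : ℝ) / 16) ≤ (n : ℝ) ^ (C + 1) := by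
    refine le_trans ?_ hnC
    have h1 : Real.exp ((m : ℝ) / 16) ≤ 1 / c * ρ⁻¹ := by
      rw [one_div, ← mul_inv, ← one_div, le_div_iff₀ (by positivity)]
      rw [hκ] at hκ1
      linarith
    refine h1.trans (mul_le_mul ?_ hρinv (by positivity) (by positivity))
    gcongr
    norm_num
  have h2m : (2 * m : ℝ) ≤ (n : ℝ) ^ (ε / 2) := by
    refine le_trans ?_ hnlog
    have h1 := Real.log_le_log (Real.exp_pos _) hexp
    rw [Real.log_exp, Real.log_rpow hnpos] at h1
    linarith
  have hn'ε : (n : ℝ) ^ ε ≤ n' := by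
    refine le_trans ?_ hn'1
    have : 1 ≤ α⁻¹ := (one_le_inv₀ (by linarith)).2 hα1
    exact le_mul_of_one_le_left (by positivity) this
  have hn'0 : (0 : ℝ) < n' := (Real.rpow_pos_of_pos hnpos _).trans_le hn'ε
  set l : ℝ := √(n' / (2 * m)) with hl
  have hl2 : l ^ 2 = n' / (2 * m) := Real.sq_sqrt (by positivity)
  have hl0 : 0 < l := Real.sqrt_pos.2 (by positivity)
  have hln : (n : ℝ) ^ (ε / 4) ≤ l := by
    refine Real.le_sqrt_of_sq_le ?_
    rw [← Real.rpow_natCast, ← Real.rpow_mul hnpos.le, le_div_iff₀ (by positivity)]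
    refine le_trans (mul_le_mul_of_nonneg_left h2m (by positivity)) ?_
    rw [← Real.rpow_add hnpos]
    refine le_trans (le_of_eq ?_) hn'ε
    congr 1
    push_cast
    ring
  have hlD : 4 / κ ≤ l ^ D := by
    calc 4 / κ = 4 / c * ρ⁻¹ / Real.exp (m / 16) := by rw [hκ]; field_simp
      _ ≤ 4 / c * ρ⁻¹ := div_le_self (by positivity) hexp1
      _ ≤ 4 / c * (n : ℝ) ^ C := mul_le_mul_of_nonneg_left hρinv (by positivity)
      _ ≤ (n : ℝ) ^ (C + 1) := hnC
      _ ≤ (n : ℝ) ^ (ε / 4 * D) := Real.rpow_le_rpow_of_exponent_le hn1 hDε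
      _ = ((n : ℝ) ^ (ε / 4)) ^ D := by rw [Real.rpow_mul hnpos.le, Real.rpow_natCast]
      _ ≤ l ^ D := pow_le_pow_left₀ (by positivity) hln _
  obtain ⟨r, hr, H, P, hsym, hprop, hcount, hsize⟩ := hstruct G n (fun i => A i + A i) S m n' κ l hm
    (by exact_mod_cast hn'0) hκ0 hS hκG (hnl.trans hln) hl2 hlD
  refine ⟨r, H, P, hr, hsym, hprop, hcount, le_max_of_le_right ?_⟩
  have hpow : (n' : ℝ) ^ ((r : ℝ) / 2) = l ^ r * √(2 * m) ^ r := by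
    rw [← mul_pow, hl, ← Real.sqrt_mul (by positivity), div_mul_cancel₀ _ (by positivity),
      Real.sqrt_eq_rpow, ← Real.rpow_natCast, ← Real.rpow_mul hn'0.le]
    congr 1
    ring
  have h2m1 : (1 : ℝ) ≤ 2 * m := by
    have : (1 : ℝ) ≤ m := by exact_mod_cast hm
    linarith
  have hsqrt : √(2 * m : ℝ) ^ r ≤ F * Real.exp (m / 16) := by
    have h1 : √(2 * m : ℝ) ≤ 2 * m := Real.sqrt_le_iff.2 ⟨by positivity, by nlinarith⟩
    exact (pow_le_pow_left₀ (Real.sqrt_nonneg _) h1 _).trans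
      ((pow_le_pow_right₀ h2m1 hr).trans (hF m))
  rw [le_div_iff₀ (by positivity), hpow, ← mul_assoc]
  calc (((H : Set G) + P.toSet).ncard : ℝ) * l ^ r * √(2 * m : ℝ) ^ r
      ≤ C₁ * (4 / κ) * (F * Real.exp (m / 16)) :=
        mul_le_mul hsize hsqrt (by positivity) (by positivity)
    _ = C₁ * (4 / c) * F * ρ⁻¹ := by
        rw [hκ]
        field_simp
end

section
/- For every ε ∈ (0,1) there exist constants C_ε, K_ε and n₀ such that the following holds for all n ≥ n₀. Let G be a finite abelian group with |G| ≥ C_ε√n, let A = {a₁, …, a_n} be a multiset of elements of G, and let x₁, …, x_n be iid random variables uniform on {−1, 1}. Suppose that there is no subgroup of G of size less than C_ε√n which contains 2a_i for at least n − εn indices i ∈ {1, …, n} (counted with multiplicity). Then sup_{a ∈ G} P(a₁x₁ + ⋯ + a_nx_n = a) ≤ K_ε/√n. -/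
/-- The probability that the random walk `∑ i, A i * x i`, with `x i` iid uniform on
`{-1, 1}`, equals `a`. -/
noncomputable def pmProb {G : Type*} [AddCommGroup G] {n : ℕ} (A : Fin n → G) (a : G) : ℝ :=
  ({x : Fin n → Bool | (∑ i, (if x i then A i else -A i)) = a}.ncard : ℝ) / 2 ^ n

open Finset in
theorem centralBinom_sq_mul_le (q : ℕ) : q.centralBinom ^ 2 * (3 * q + 1) ≤ 16 ^ q := by
  induction q with
  | zero => simp
  | succ q ih =>
    have h := Nat.succ_mul_centralBinom_succ q
    have key : (q + 1) ^ 2 * ((q + 1).centralBinom ^ 2 * (3 * (q + 1) + 1)) ≤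
        (q + 1) ^ 2 * 16 ^ (q + 1) := by
      calc (q + 1) ^ 2 * ((q + 1).centralBinom ^ 2 * (3 * (q + 1) + 1))
          = ((q + 1) * (q + 1).centralBinom) ^ 2 * (3 * q + 4) := by ring
        _ = q.centralBinom ^ 2 * (4 * (2 * q + 1) ^ 2 * (3 * q + 4)) := by rw [h]; ring
        _ ≤ q.centralBinom ^ 2 * (16 * (q + 1) ^ 2 * (3 * q + 1)) := by
            refine Nat.mul_le_mul_left _ ?_
            nlinarith
        _ = 16 * (q + 1) ^ 2 * (q.centralBinom ^ 2 * (3 * q + 1)) := by ring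
        _ ≤ 16 * (q + 1) ^ 2 * 16 ^ q := by gcongr
        _ = (q + 1) ^ 2 * 16 ^ (q + 1) := by ring
    exact Nat.le_of_mul_le_mul_left key (by positivity)

theorem choose_le_choose_of_le_half {q z t : ℕ} (hzt : z ≤ t) (ht : t ≤ q) :
    (2 * q).choose z ≤ (2 * q).choose t := by
  induction t, hzt using Nat.le_induction with
  | base => rfl
  | succ t _ ih => exact (ih (by lia)).trans (Nat.choose_le_succ_of_lt_half_left (by lia))

theorem choose_le_choose_of_half_le {q z t : ℕ} (htz : t ≤ z) (ht : q ≤ t) :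
    (2 * q).choose z ≤ (2 * q).choose t := by
  rcases lt_or_ge (2 * q) z with hz | hz
  · simp [Nat.choose_eq_zero_of_lt hz]
  · rw [← Nat.choose_symm hz, ← Nat.choose_symm (htz.trans hz)]
    exact choose_le_choose_of_le_half (by lia) (by lia)

open Finset in
/-- The binomial weights on an `m`-separated set of integers carry mass about `1 / m`. -/
theorem mul_sum_choose_le {q m : ℕ} {Z : Finset ℕ} (hZ : Z ⊆ range (2 * q + 1))
    (hsep : ∀ z ∈ Z, ∀ z' ∈ Z, z < z' → z + m ≤ z') :
    m * ∑ z ∈ Z, (2 * q).choose z ≤ 4 ^ q + m * (2 * q.centralBinom) := by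
  classical
  rcases m.eq_zero_or_pos with rfl | hm
  · simp
  let I : ℕ → Finset ℕ := fun z => if z < q then Ico z (z + m) else Ioc (z - m) z
  let far : ℕ → Prop := fun z => z + m ≤ q ∨ q + m ≤ z
  have hfar : m * ∑ z ∈ Z with far z, (2 * q).choose z ≤ 4 ^ q := by
    calc m * ∑ z ∈ Z with far z, (2 * q).choose z
        ≤ ∑ z ∈ Z with far z, ∑ t ∈ I z, (2 * q).choose t := by
          rw [mul_sum]
          refine sum_le_sum fun z hz => ?_
          rw [mem_filter] at hz
          rcases hz.2 with h | h
          · have : I z = Ico z (z + m) := if_pos (by lia)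
            rw [this]
            have := card_nsmul_le_sum (Ico z (z + m)) (fun t => (2 * q).choose t)
              ((2 * q).choose z) fun t ht => by
                rw [mem_Ico] at ht
                exact choose_le_choose_of_le_half ht.1 (by lia)
            simpa using this
          · have : I z = Ioc (z - m) z := if_neg (by lia)
            rw [this]
            have := card_nsmul_le_sum (Ioc (z - m) z) (fun t => (2 * q).choose t)
              ((2 * q).choose z) fun t ht => by
                rw [mem_Ioc] at ht
                exact choose_le_choose_of_half_le ht.2 (by lia)
            have hc : z - (z - m) = m := by lia
            simpa [hc] using this
      _ = ∑ t ∈ (Z.filter far).biUnion I, (2 * q).choose t := by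
          rw [sum_biUnion]
          intro z hz z' hz' hne
          rw [mem_coe, mem_filter] at hz hz'
          refine disjoint_left.2 fun t ht ht' => ?_
          have h1 := hsep z hz.1 z' hz'.1
          have h2 := hsep z' hz'.1 z hz.1
          have h3 := hz.2
          have h4 := hz'.2
          simp only [I, far] at ht ht' h3 h4
          split_ifs at ht ht' <;> simp only [mem_Ico, mem_Ioc] at ht ht' <;> lia
      _ ≤ ∑ t ∈ range (2 * q + 1), (2 * q).choose t := by
          refine sum_le_sum_of_subset fun t ht => ?_
          rw [mem_biUnion] at ht
          obtain ⟨z, hz, ht⟩ := ht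
          rw [mem_filter] at hz
          have h1 := mem_range.1 (hZ hz.1)
          have h3 := hz.2
          simp only [I, far] at ht h3
          rw [mem_range]
          split_ifs at ht <;> simp only [mem_Ico, mem_Ioc] at ht <;> lia
      _ = 4 ^ q := by rw [Nat.sum_range_choose, pow_mul]; norm_num
  have hnear : ∑ z ∈ Z with ¬ far z, (2 * q).choose z ≤ 2 * q.centralBinom := by
    have hcard : #(Z.filter fun z => ¬ far z) ≤ 2 := by
      by_contra! h
      obtain ⟨x, y, z, hx, hy, hz, hxy, hxz, hyz⟩ := two_lt_card_iff.1 h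
      simp only [mem_filter, far] at hx hy hz
      have := hsep x hx.1 y hy.1
      have := hsep y hy.1 x hx.1
      have := hsep x hx.1 z hz.1
      have := hsep z hz.1 x hx.1
      have := hsep y hy.1 z hz.1
      have := hsep z hz.1 y hy.1
      lia
    refine (sum_le_card_nsmul _ _ q.centralBinom fun z _ => Nat.choose_le_centralBinom z q).trans ?_
    rw [smul_eq_mul]
    gcongr
  rw [← sum_filter_add_sum_filter_not Z far, mul_add]
  gcongr

theorem exists_period {G : Type*} [AddCommGroup G] [Finite G] {H : AddSubgroup G} {b : G}
    (hb : b ∉ H) :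
    ∃ m : ℕ, 2 ≤ m ∧ (∀ k : ℤ, k • b ∈ H → (m : ℤ) ∣ k) ∧
      Nat.card (AddSubgroup.zmultiples b ⊔ H : AddSubgroup G) ≤ m * Nat.card H := by
  have hdvd (k : ℤ) : k • b ∈ H ↔ (addOrderOf (b : G ⧸ H) : ℤ) ∣ k := by
    rw [addOrderOf_dvd_iff_zsmul_eq_zero, ← QuotientAddGroup.mk_zsmul,
      QuotientAddGroup.eq_zero_iff]
  have hpos : 0 < addOrderOf (b : G ⧸ H) := addOrderOf_pos _
  have hne : addOrderOf (b : G ⧸ H) ≠ 1 := fun h => hb <| by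
    simpa using (hdvd 1).2 (by simp [h])
  refine ⟨addOrderOf (b : G ⧸ H), by lia, fun k => (hdvd k).1, ?_⟩
  set m := addOrderOf (b : G ⧸ H)
  have hmem (p : Fin m × H) : (p.1 : ℕ) • b + p.2 ∈ AddSubgroup.zmultiples b ⊔ H :=
    add_mem (AddSubgroup.mem_sup_left (AddSubgroup.nsmul_mem_zmultiples b _))
      (AddSubgroup.mem_sup_right p.2.2)
  have hsurj : Function.Surjective
      fun p : Fin m × H => (⟨_, hmem p⟩ : (AddSubgroup.zmultiples b ⊔ H : AddSubgroup G)) := by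
    rintro ⟨x, hx⟩
    obtain ⟨_, ⟨k, rfl⟩, h, hh, rfl⟩ := AddSubgroup.mem_sup.1 hx
    have hk0 : 0 ≤ k % m := Int.emod_nonneg _ (by lia)
    have hkm : k % m < m := Int.emod_lt_of_pos _ (by lia)
    have hper : (k - k % m) • b ∈ H := (hdvd _).2 (Int.dvd_self_sub_emod)
    refine ⟨⟨⟨(k % m).toNat, by lia⟩, ⟨(k - k % m) • b + h, add_mem hper hh⟩⟩, ?_⟩
    ext
    have : ((k % m).toNat : ℕ) • b = (k % m) • b := by
      rw [← natCast_zsmul, Int.toNat_of_nonneg hk0]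
    simp only [this, sub_smul]
    abel
  simpa using Nat.card_le_card_of_surjective _ hsurj

/-- Finite index sets whose elements can be listed so that each `b i` lies outside the subgroup
generated by the previous ones. -/
inductive IsChainIndep {ι G : Type*} [DecidableEq ι] [AddCommGroup G] (b : ι → G) :
    Finset ι → Prop
  | empty : IsChainIndep b ∅
  | extend {s : Finset ι} {i : ι} : IsChainIndep b s →
      b i ∉ AddSubgroup.closure (b '' s) → IsChainIndep b (insert i s)

theorem notMem_of_apply_notMem_closure {ι G : Type*} [AddCommGroup G] {b : ι → G} {s : Finset ι} {i : ι}
    (h : b i ∉ AddSubgroup.closure (b '' s)) : i ∉ s :=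
  fun hi => h (AddSubgroup.subset_closure ⟨i, hi, rfl⟩)

theorem closure_image_insert {ι G : Type*} [DecidableEq ι] [AddCommGroup G] (b : ι → G)
    (s : Finset ι) (i : ι) :
    AddSubgroup.closure (b '' (insert i s : Finset ι)) =
      AddSubgroup.zmultiples (b i) ⊔ AddSubgroup.closure (b '' s) := by
  rw [Finset.coe_insert, Set.image_insert_eq, Set.insert_eq, AddSubgroup.closure_union,
    AddSubgroup.zmultiples_eq_closure]

theorem IsChainIndep.card_lt {ι G : Type*} [DecidableEq ι] [AddCommGroup G] [Finite G] {b : ι → G}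
    {s : Finset ι} (hs : IsChainIndep b s) :
    s.card < Nat.card (AddSubgroup.closure (b '' s)) := by
  induction hs with
  | empty => simp
  | @extend s i _ hi ih =>
    rw [Finset.card_insert_of_notMem (notMem_of_apply_notMem_closure hi)]
    refine lt_of_le_of_lt ih ?_
    have hlt : AddSubgroup.closure (b '' s) < AddSubgroup.closure (b '' (insert i s : Finset ι)) := by
      refine lt_of_le_of_ne (AddSubgroup.closure_mono (Set.image_mono (by simp))) fun h => hi ?_
      rw [h]
      exact AddSubgroup.subset_closure ⟨i, by simp, rfl⟩
    exact Set.ncard_lt_ncard (SetLike.coe_ssubset_coe.2 hlt) (Set.toFinite _)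

/-- Inside any index set generating a subgroup with at least `t` elements there is a chain of
length at most `t` already generating at least `t` elements. -/
theorem exists_isChainIndep {ι G : Type*} [DecidableEq ι] [AddCommGroup G] [Finite G] {b : ι → G}
    {R : Finset ι} {t : ℕ} (hR : t ≤ Nat.card (AddSubgroup.closure (b '' R))) :
    ∃ s ⊆ R, IsChainIndep b s ∧ s.card ≤ t ∧ t ≤ Nat.card (AddSubgroup.closure (b '' s)) := by
  have key (k : ℕ) : ∃ s ⊆ R, IsChainIndep b s ∧ s.card ≤ k ∧
      (s.card = k ∨ t ≤ Nat.card (AddSubgroup.closure (b '' s))) := by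
    induction k with
    | zero => exact ⟨∅, by simp, .empty, by simp, by simp⟩
    | succ k ih =>
      obtain ⟨s, hsR, hs, hk, h⟩ := ih
      rcases lt_or_ge (Nat.card (AddSubgroup.closure (b '' s))) t with hlt | hge
      · obtain ⟨i, hiR, hi⟩ : ∃ i ∈ R, b i ∉ AddSubgroup.closure (b '' s) := by
          by_contra! hall
          have hle : AddSubgroup.closure (b '' R) ≤ AddSubgroup.closure (b '' s) := by
            rw [AddSubgroup.closure_le]
            rintro _ ⟨i, hi, rfl⟩
            exact hall i hi
          have := Nat.card_mono (Set.toFinite _) (SetLike.coe_subset_coe.2 hle)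
          exact absurd (hR.trans this) (not_le.2 hlt)
        have hc := Finset.card_insert_of_notMem (notMem_of_apply_notMem_closure hi)
        exact ⟨insert i s, Finset.insert_subset hiR hsR, hs.extend hi, by lia, Or.inl (by lia)⟩
      · exact ⟨s, hsR, hs, by lia, Or.inr hge⟩
  obtain ⟨s, hsR, hs, hk, h⟩ := key t
  refine ⟨s, hsR, hs, hk, ?_⟩
  rcases h with h | h
  · exact h ▸ hs.card_lt.le
  · exact h

/-- The Fourier transform at `c` of the product of `cos ^ (2 * q)` weights over `s`. -/
noncomputable def cosMean {ι G : Type*} [AddCommGroup G] [Fintype G] (A : ι → G) (q : ℕ)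
    (s : Finset ι) (c : G) : ℂ :=
  (∑ χ : AddChar G ℂ, χ c * ∏ i ∈ s, ((χ (A i)).re : ℂ) ^ (2 * q)) / Fintype.card G

theorem AddChar.ofReal_re_apply {G : Type*} [AddCommGroup G] [Finite G] (χ : AddChar G ℂ) (a : G) :
    ((χ a).re : ℂ) = (χ a + χ (-a)) / 2 := by
  rw [AddChar.map_neg_eq_conj, Complex.re_eq_add_conj]

theorem AddChar.ofReal_re_apply_pow {G : Type*} [AddCommGroup G] [Finite G] (χ : AddChar G ℂ)
    (a : G) (q : ℕ) :
    ((χ a).re : ℂ) ^ (2 * q) = ∑ z ∈ Finset.range (2 * q + 1),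
      ((2 * q).choose z / 4 ^ q : ℂ) * χ (z • (a + a) - q • (a + a)) := by
  rw [AddChar.ofReal_re_apply, div_pow, add_pow, Finset.sum_div]
  refine Finset.sum_congr rfl fun z hz => ?_
  have hz' : z ≤ 2 * q := by simpa [Nat.lt_succ_iff] using hz
  have h : z • (a + a) - q • (a + a) = z • a + (2 * q - z) • (-a) := by
    rw [← natCast_zsmul (-a), Nat.cast_sub hz']
    simp only [← natCast_zsmul]
    push_cast
    module
  rw [h, AddChar.map_add_eq_mul, AddChar.map_nsmul_eq_pow, AddChar.map_nsmul_eq_pow, pow_mul 2]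
  norm_num
  ring

theorem cosMean_empty {ι G : Type*} [AddCommGroup G] [Fintype G] [DecidableEq G] (A : ι → G)
    (q : ℕ) (c : G) : cosMean A q ∅ c = if c = 0 then 1 else 0 := by
  simp only [cosMean, Finset.prod_empty, mul_one, AddChar.sum_apply_eq_ite]
  split_ifs <;> simp

theorem cosMean_insert {ι G : Type*} [DecidableEq ι] [AddCommGroup G] [Fintype G] (A : ι → G)
    (q : ℕ) {s : Finset ι} {i : ι} (hi : i ∉ s) (c : G) :
    cosMean A q (insert i s) c = ∑ z ∈ Finset.range (2 * q + 1),
      ((2 * q).choose z / 4 ^ q : ℂ) *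
        cosMean A q s (c + (z • (A i + A i) - q • (A i + A i))) := by
  simp only [cosMean, Finset.prod_insert hi, AddChar.ofReal_re_apply_pow _ (A i),
    AddChar.map_add_eq_mul _ c, Finset.sum_mul, Finset.mul_sum, Finset.sum_div, mul_div_assoc']
  rw [Finset.sum_comm]
  refine Finset.sum_congr rfl fun z _ => Finset.sum_congr rfl fun χ _ => ?_
  ring

theorem exists_cosMean_eq_le {ι G : Type*} [DecidableEq ι] [AddCommGroup G] [Fintype G]
    (A : ι → G) {q : ℕ} {M : ℝ} (hM : M = 2 * q.centralBinom / 4 ^ q) {s : Finset ι}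
    (hs : IsChainIndep (fun i => A i + A i) s) :
    ∃ (r : G → ℝ) (P : ℕ), (∀ c, cosMean A q s c = r c) ∧ (∀ c, 0 ≤ r c) ∧
      (∀ c ∉ AddSubgroup.closure ((fun i => A i + A i) '' s), r c = 0) ∧
      Nat.card (AddSubgroup.closure ((fun i => A i + A i) '' s)) ≤ P ∧ 2 ^ s.card ≤ P ∧
      ∀ c, r c ≤ 1 / P + ((1 / 2 + M) ^ s.card - (1 / 2) ^ s.card) := by
  classical
  have hM0 : 0 ≤ M := by rw [hM]; positivity
  induction hs with
  | empty =>
    refine ⟨fun c => if c = 0 then 1 else 0, 1, fun c => ?_, fun c => ?_, fun c hc => ?_, ?_, ?_,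
      fun c => ?_⟩
    · rw [cosMean_empty]; split_ifs <;> simp [*]
    · positivity
    · have : c ≠ 0 := by rintro rfl; exact hc (zero_mem _)
      simp [this]
    · simp
    · simp
    · dsimp only; split_ifs <;> simp
  | @extend s i hs hi ih =>
    obtain ⟨r, P, hr, hr0, hrs, hPH, hP2, hrP⟩ := ih
    have his : i ∉ s := notMem_of_apply_notMem_closure hi
    obtain ⟨m, hm2, hmdvd, hmcard⟩ := exists_period hi
    set H := AddSubgroup.closure ((fun i => A i + A i) '' (s : Set ι)) with hH
    set b := A i + A i with hb
    have hcl := closure_image_insert (fun i => A i + A i) s i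
    rw [← hH] at hcl
    set w : ℕ → ℝ := fun z => (2 * q).choose z / 4 ^ q with hw
    have hw0 (z : ℕ) : 0 ≤ w z := by positivity
    set d := s.card with hd
    set B : ℝ := 1 / P + ((1 / 2 + M) ^ d - (1 / 2) ^ d) with hB
    have hPpos : (0 : ℝ) < P := by
      have : 0 < P := lt_of_lt_of_le (by positivity) hP2
      exact_mod_cast this
    have hX : 0 ≤ (1 / 2 + M) ^ d - (1 / 2) ^ d :=
      sub_nonneg.2 (pow_le_pow_left₀ (by norm_num) (by linarith) _)
    have hB0 : 0 ≤ B := by positivity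
    have hm0 : (0 : ℝ) < m := by exact_mod_cast (by lia : 0 < m)
    refine ⟨fun c => ∑ z ∈ Finset.range (2 * q + 1), w z * r (c + (z • b - q • b)), m * P,
      fun c => ?_, fun c => ?_, fun c hc => ?_, ?_, ?_, fun c => ?_⟩
    · rw [cosMean_insert A q his]
      simp only [hr, hw]
      push_cast
      rfl
    · exact Finset.sum_nonneg fun z _ => mul_nonneg (hw0 z) (hr0 _)
    · refine Finset.sum_eq_zero fun z _ => ?_
      rw [hrs, mul_zero]
      intro hmem
      refine hc ?_
      rw [hcl]
      have hbm : b ∈ AddSubgroup.zmultiples b ⊔ H :=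
        AddSubgroup.mem_sup_left (AddSubgroup.mem_zmultiples b)
      have := sub_mem (AddSubgroup.mem_sup_right (S := AddSubgroup.zmultiples b) hmem)
        (sub_mem (nsmul_mem hbm z) (nsmul_mem hbm q))
      simpa using this
    · rw [hcl]
      exact hmcard.trans (Nat.mul_le_mul_left _ hPH)
    · rw [Finset.card_insert_of_notMem his, pow_succ']
      exact Nat.mul_le_mul hm2 hP2
    · rw [Finset.card_insert_of_notMem his]
      set Z := (Finset.range (2 * q + 1)).filter fun z => c + (z • b - q • b) ∈ H with hZ
      have hsep : ∀ z ∈ Z, ∀ z' ∈ Z, z < z' → z + m ≤ z' := by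
        intro z hz z' hz' hlt
        have h1 := (Finset.mem_filter.1 hz).2
        have h2 := (Finset.mem_filter.1 hz').2
        have h3 : ((z' : ℤ) - z) • b ∈ H := by
          have := sub_mem h2 h1
          rw [sub_smul, natCast_zsmul, natCast_zsmul]
          convert this using 1
          abel
        have := Int.le_of_dvd (by lia) (hmdvd _ h3)
        lia
      have hmass : ∑ z ∈ Z, w z ≤ 1 / m + M := by
        have h := mul_sum_choose_le (Finset.filter_subset _ _) hsep
        have h' : (m : ℝ) * ∑ z ∈ Z, ((2 * q).choose z : ℝ) ≤
            4 ^ q + m * (2 * q.centralBinom) := by exact_mod_cast h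
        rw [hM, hw, ← Finset.sum_div, div_add_div _ _ hm0.ne' (by positivity),
          div_le_div_iff₀ (by positivity) (by positivity)]
        have h4 : (0 : ℝ) < 4 ^ q := by positivity
        nlinarith
      have hP2' : (1 : ℝ) / P ≤ (1 / 2) ^ d := by
        rw [div_pow, one_pow]
        exact one_div_le_one_div_of_le (by positivity) (by exact_mod_cast hP2)
      have hm2' : (1 : ℝ) / m ≤ 1 / 2 :=
        one_div_le_one_div_of_le (by norm_num) (by exact_mod_cast hm2)
      calc ∑ z ∈ Finset.range (2 * q + 1), w z * r (c + (z • b - q • b))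
          = ∑ z ∈ Z, w z * r (c + (z • b - q • b)) := by
            rw [hZ, Finset.sum_filter]
            refine Finset.sum_congr rfl fun z _ => ?_
            split_ifs with h
            · rfl
            · rw [hrs _ h, mul_zero]
        _ ≤ ∑ z ∈ Z, w z * B :=
            Finset.sum_le_sum fun z _ => mul_le_mul_of_nonneg_left (hrP _) (hw0 z)
        _ = (∑ z ∈ Z, w z) * B := by rw [Finset.sum_mul]
        _ ≤ (1 / m + M) * B := by gcongr
        _ = 1 / m * (1 / P) + M * (1 / P) +
              (1 / m + M) * ((1 / 2 + M) ^ d - (1 / 2) ^ d) := by rw [hB]; ring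
        _ ≤ 1 / m * (1 / P) + M * (1 / 2) ^ d +
              (1 / 2 + M) * ((1 / 2 + M) ^ d - (1 / 2) ^ d) := by gcongr
        _ = 1 / ((m * P : ℕ) : ℝ) + ((1 / 2 + M) ^ (d + 1) - (1 / 2) ^ (d + 1)) := by
            push_cast
            rw [one_div_mul_one_div]
            ring

theorem pmProb_le_mean {G : Type*} [AddCommGroup G] [Fintype G] {n : ℕ} (A : Fin n → G) (a : G) :
    pmProb A a ≤ (∑ χ : AddChar G ℂ, ∏ i, |(χ (A i)).re|) / Fintype.card G := by
  classical
  have hG : (Fintype.card G : ℂ) ≠ 0 := Nat.cast_ne_zero.2 Fintype.card_ne_zero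
  have hcount : ((Fintype.card G : ℂ) *
      ({x : Fin n → Bool | (∑ i, (if x i then A i else -A i)) = a}.ncard : ℂ)) =
      2 ^ n * ∑ χ : AddChar G ℂ, χ (-a) * ∏ i, ((χ (A i)).re : ℂ) := by
    calc ((Fintype.card G : ℂ) *
          ({x : Fin n → Bool | (∑ i, (if x i then A i else -A i)) = a}.ncard : ℂ))
        = ∑ x : Fin n → Bool, ∑ χ : AddChar G ℂ,
            χ (-a + ∑ i, (if x i then A i else -A i)) := by
          simp only [AddChar.sum_apply_eq_ite, neg_add_eq_zero, Finset.sum_ite,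
            Finset.sum_const_zero, add_zero, Finset.sum_const, nsmul_eq_mul]
          rw [mul_comm, Set.ncard_eq_toFinset_card']
          simp only [Set.toFinset_ofPred, eq_comm]
      _ = ∑ χ : AddChar G ℂ, χ (-a) * ∏ i, ∑ y : Bool, χ (if y then A i else -A i) := by
          rw [Finset.sum_comm]
          refine Finset.sum_congr rfl fun χ _ => ?_
          rw [Finset.prod_univ_sum, Fintype.piFinset_univ, Finset.mul_sum]
          refine Finset.sum_congr rfl fun x _ => ?_
          rw [AddChar.map_add_eq_mul]
          congr 1
          exact map_prod χ.toMonoidHom (fun i => Multiplicative.ofAdd _) _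
      _ = 2 ^ n * ∑ χ : AddChar G ℂ, χ (-a) * ∏ i, ((χ (A i)).re : ℂ) := by
          rw [Finset.mul_sum]
          refine Finset.sum_congr rfl fun χ _ => ?_
          simp only [AddChar.ofReal_re_apply, Finset.prod_div_distrib, Finset.prod_const,
            Finset.card_univ, Fintype.card_fin, Fintype.sum_bool, if_true, Bool.false_eq_true,
            if_false]
          field_simp
  have hprob : (pmProb A a : ℂ) =
      (∑ χ : AddChar G ℂ, χ (-a) * ∏ i, ((χ (A i)).re : ℂ)) / Fintype.card G := by
    rw [pmProb]
    push_cast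
    rw [div_eq_div_iff (pow_ne_zero _ two_ne_zero) hG, mul_comm, hcount, mul_comm]
  calc pmProb A a ≤ ‖(pmProb A a : ℂ)‖ := by
        rw [Complex.norm_real]; exact le_abs_self _
    _ = ‖∑ χ : AddChar G ℂ, χ (-a) * ∏ i, ((χ (A i)).re : ℂ)‖ / Fintype.card G := by
        rw [hprob, norm_div, Complex.norm_natCast]
    _ ≤ (∑ χ : AddChar G ℂ, ∏ i, |(χ (A i)).re|) / Fintype.card G := by
        gcongr
        refine (norm_sum_le _ _).trans (Finset.sum_le_sum fun χ _ => ?_)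
        rw [norm_mul, AddChar.norm_apply, one_mul, norm_prod]
        simp

/-- Weighted AM-GM for numbers in `[0, 1]`, with integer exponents. -/
theorem prod_le_sum_mul_pow {κ : Type*} (S : Finset κ) (w g : κ → ℝ) (e : κ → ℕ)
    (hw : ∀ j ∈ S, 0 ≤ w j) (hw1 : ∑ j ∈ S, w j = 1) (hg0 : ∀ j ∈ S, 0 ≤ g j)
    (hg1 : ∀ j ∈ S, g j ≤ 1) (he : ∀ j ∈ S, e j * w j ≤ 1) :
    ∏ j ∈ S, g j ≤ ∑ j ∈ S, w j * g j ^ e j := by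
  refine le_trans (Finset.prod_le_prod hg0 fun j hj => ?_)
    (Real.geom_mean_le_arith_mean_weighted S w (fun j => g j ^ e j) hw hw1
      fun j hj => pow_nonneg (hg0 j hj) _)
  rw [← Real.rpow_natCast, ← Real.rpow_mul (hg0 j hj)]
  exact Real.self_le_rpow_of_le_one (hg0 j hj) (hg1 j hj) (he j hj)

theorem sq_mul_three_pow_le (d : ℕ) : d ^ 2 * 3 ^ d ≤ 16 * 4 ^ d := by
  rcases lt_or_ge d 7 with h | h
  · interval_cases d <;> norm_num
  · induction d, h using Nat.le_induction with
    | base => norm_num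
    | succ d hd ih =>
      calc (d + 1) ^ 2 * 3 ^ (d + 1) = (3 * (d + 1) ^ 2) * 3 ^ d := by ring
        _ ≤ (4 * d ^ 2) * 3 ^ d := Nat.mul_le_mul_right _ (by nlinarith)
        _ = 4 * (d ^ 2 * 3 ^ d) := by ring
        _ ≤ 4 * (16 * 4 ^ d) := by gcongr
        _ = 16 * 4 ^ (d + 1) := by ring

theorem half_add_pow_sub_le {d N : ℕ} (hd : 0 < d) (hN : 42 * d ≤ N) :
    (1 / 2 + 2 * ((N / (2 * d)).centralBinom : ℝ) / 4 ^ (N / (2 * d))) ^ d - (1 / 2) ^ d ≤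
      43 / √N := by
  set q := N / (2 * d) with hq
  set M : ℝ := 2 * (q.centralBinom : ℝ) / 4 ^ q with hM
  have hq21 : 21 ≤ q := (Nat.le_div_iff_mul_le (by lia)).2 (by lia)
  have hNq : N ≤ (3 * q + 1) * d := by
    have h := Nat.lt_mul_div_succ N (b := 2 * d) (by lia)
    rw [← hq] at h
    nlinarith
  have hd0 : (0 : ℝ) < d := by exact_mod_cast hd
  have hN0 : (0 : ℝ) < N := by exact_mod_cast (by lia : 0 < N)
  have hM0 : 0 ≤ M := by positivity
  have hMsq : M ^ 2 * (3 * q + 1) ≤ 4 := by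
    have h : (q.centralBinom : ℝ) ^ 2 * (3 * q + 1) ≤ 16 ^ q := by
      exact_mod_cast centralBinom_sq_mul_le q
    have h4 : ((4 : ℝ) ^ q) ^ 2 = 16 ^ q := by rw [← pow_mul, mul_comm, pow_mul]; norm_num
    rw [hM, div_pow, h4, div_mul_eq_mul_div, div_le_iff₀ (by positivity)]
    linarith
  have hM4 : M ≤ 1 / 4 := by
    have : (21 : ℝ) ≤ q := by exact_mod_cast hq21
    by_contra! h
    nlinarith
  have hMd : M ≤ 2 * d / √N := by
    rw [le_div_iff₀ (by positivity)]
    refine le_of_sq_le_sq ?_ (by positivity)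
    rw [mul_pow, Real.sq_sqrt hN0.le]
    have h1 : (N : ℝ) ≤ (3 * q + 1) * d := by exact_mod_cast hNq
    have h2 : (1 : ℝ) ≤ d := by exact_mod_cast hd
    calc M ^ 2 * N ≤ M ^ 2 * ((3 * q + 1) * d) := by gcongr
      _ = (M ^ 2 * (3 * q + 1)) * d := by ring
      _ ≤ 4 * d := by gcongr
      _ ≤ (2 * d) ^ 2 := by nlinarith
  have hpow : (d : ℝ) ^ 2 * (3 / 4) ^ (d - 1) ≤ 64 / 3 := by
    have h : (d : ℝ) ^ 2 * 3 ^ d ≤ 16 * 4 ^ d := by exact_mod_cast sq_mul_three_pow_le d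
    have h' : (d : ℝ) ^ 2 * (3 / 4) ^ d ≤ 16 := by
      rw [div_pow, mul_div_assoc', div_le_iff₀ (by positivity)]
      exact h
    obtain ⟨k, rfl⟩ : ∃ k, d = k + 1 := ⟨d - 1, by lia⟩
    rw [pow_succ (3 / 4 : ℝ)] at h'
    simp only [Nat.add_sub_cancel]
    linarith
  calc (1 / 2 + M) ^ d - (1 / 2) ^ d
      ≤ |1 / 2 + M - 1 / 2| * d * max |1 / 2 + M| |1 / 2| ^ (d - 1) :=
        (le_abs_self _).trans (abs_pow_sub_pow_le _ _ _)
    _ ≤ M * d * (3 / 4) ^ (d - 1) := by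
        rw [add_sub_cancel_left, abs_of_nonneg hM0]
        gcongr
        refine max_le ?_ ?_ <;> rw [abs_of_nonneg (by positivity)] <;> linarith
    _ ≤ 2 * d / √N * d * (3 / 4) ^ (d - 1) := by gcongr
    _ = 2 * (d ^ 2 * (3 / 4) ^ (d - 1)) / √N := by ring
    _ ≤ 43 / √N := by
        gcongr
        linarith

theorem mean_prod_pow_le {ι G : Type*} [DecidableEq ι] [AddCommGroup G] [Fintype G] (A : ι → G)
    {s : Finset ι} (hs : IsChainIndep (fun i => A i + A i) s) (hne : s.Nonempty) {t N : ℕ}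
    (ht : 0 < t) (hst : t ≤ Nat.card (AddSubgroup.closure ((fun i => A i + A i) '' s)))
    (hN : 42 * s.card ≤ N) :
    (∑ χ : AddChar G ℂ, (∏ i ∈ s, |(χ (A i)).re|) ^ (2 * (N / (2 * s.card)))) / Fintype.card G ≤
      1 / t + 43 / √N := by
  obtain ⟨r, P, hr, -, -, hP, -, hrP⟩ := exists_cosMean_eq_le A (q := N / (2 * s.card)) rfl hs
  have hmean : (∑ χ : AddChar G ℂ, (∏ i ∈ s, |(χ (A i)).re|) ^ (2 * (N / (2 * s.card)))) /
      Fintype.card G = r 0 := by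
    have h := hr 0
    simp only [cosMean, AddChar.map_zero_eq_one, one_mul] at h
    simp only [← Finset.prod_pow, (even_two_mul _).pow_abs]
    exact_mod_cast h
  rw [hmean]
  refine (hrP 0).trans (add_le_add ?_ (half_add_pow_sub_le hne.card_pos hN))
  exact one_div_le_one_div_of_le (by exact_mod_cast ht) (by exact_mod_cast hst.trans hP)

/-- Disjoint chain-independent blocks covering `N` indices, each generating at least `t` elements,
give a concentration bound. -/
theorem pmProb_le_of_blocks {G : Type*} [AddCommGroup G] [Fintype G] {n : ℕ} (A : Fin n → G)
    (a : G) {𝓑 : Finset (Finset (Fin n))} {t N : ℕ} (ht : 0 < t)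
    (hdisj : (𝓑 : Set (Finset (Fin n))).PairwiseDisjoint id)
    (hB : ∀ s ∈ 𝓑, IsChainIndep (fun i => A i + A i) s ∧ s.Nonempty ∧
      t ≤ Nat.card (AddSubgroup.closure ((fun i => A i + A i) '' s)) ∧ 42 * s.card ≤ N)
    (hN : N = (𝓑.biUnion id).card) (hN0 : 0 < N) :
    pmProb A a ≤ 1 / t + 43 / √N := by
  classical
  have hNr : (0 : ℝ) < N := by exact_mod_cast hN0
  have hre (χ : AddChar G ℂ) (i : Fin n) : |(χ (A i)).re| ≤ 1 :=
    (Complex.abs_re_le_norm _).trans (AddChar.norm_apply χ _).le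
  set w : Finset (Fin n) → ℝ := fun s => s.card / N with hw
  have hw1 : ∑ s ∈ 𝓑, w s = 1 := by
    rw [hw, ← Finset.sum_div, ← Nat.cast_sum, div_eq_one_iff_eq hNr.ne', hN,
      Finset.card_biUnion hdisj]
    rfl
  have hprod (χ : AddChar G ℂ) : ∏ i, |(χ (A i)).re| ≤
      ∑ s ∈ 𝓑, w s * (∏ i ∈ s, |(χ (A i)).re|) ^ (2 * (N / (2 * s.card))) := by
    calc ∏ i, |(χ (A i)).re| ≤ ∏ i ∈ 𝓑.biUnion id, |(χ (A i)).re| :=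
          Finset.prod_le_prod_of_subset_of_le_one (Finset.subset_univ _)
            (fun i _ => abs_nonneg _) fun i _ _ => hre χ i
      _ = ∏ s ∈ 𝓑, ∏ i ∈ s, |(χ (A i)).re| := Finset.prod_biUnion hdisj
      _ ≤ _ := by
          refine prod_le_sum_mul_pow 𝓑 w _ (fun s => 2 * (N / (2 * s.card)))
            (fun s _ => by positivity) hw1
            (fun s _ => Finset.prod_nonneg fun i _ => abs_nonneg _)
            (fun s _ => Finset.prod_le_one (fun i _ => abs_nonneg _) fun i _ => hre χ i)
            fun s _ => ?_
          rw [hw, mul_div_assoc', div_le_one hNr]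
          have := Nat.div_mul_le_self N (2 * s.card)
          exact_mod_cast (by linarith : 2 * (N / (2 * s.card)) * s.card ≤ N)
  calc pmProb A a ≤ (∑ χ : AddChar G ℂ, ∏ i, |(χ (A i)).re|) / Fintype.card G :=
        pmProb_le_mean A a
    _ ≤ (∑ χ : AddChar G ℂ, ∑ s ∈ 𝓑,
          w s * (∏ i ∈ s, |(χ (A i)).re|) ^ (2 * (N / (2 * s.card)))) / Fintype.card G := by
        gcongr with χ
        exact hprod χ
    _ = ∑ s ∈ 𝓑, w s * ((∑ χ : AddChar G ℂ,
          (∏ i ∈ s, |(χ (A i)).re|) ^ (2 * (N / (2 * s.card)))) / Fintype.card G) := by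
        rw [Finset.sum_comm, Finset.sum_div]
        simp only [← Finset.mul_sum, mul_div_assoc]
    _ ≤ ∑ s ∈ 𝓑, w s * (1 / t + 43 / √N) := by
        gcongr with s hs
        obtain ⟨h1, h2, h3, h4⟩ := hB s hs
        exact mean_prod_pow_le A h1 h2 ht h3 h4
    _ = 1 / t + 43 / √N := by rw [← Finset.sum_mul, hw1, one_mul]

/-- A family of disjoint blocks that cannot be extended leaves only few indices uncovered. -/
theorem exists_blocks {ι G : Type*} [Fintype ι] [DecidableEq ι] [AddCommGroup G] [Finite G]
    (b : ι → G) {t : ℕ} (ht : 1 < t) :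
    ∃ 𝓑 : Finset (Finset ι), (𝓑 : Set (Finset ι)).PairwiseDisjoint id ∧
      (∀ s ∈ 𝓑, IsChainIndep b s ∧ s.Nonempty ∧
        t ≤ Nat.card (AddSubgroup.closure (b '' s)) ∧ s.card ≤ t) ∧
      Nat.card (AddSubgroup.closure (b '' ((𝓑.biUnion id)ᶜ : Finset ι))) < t := by
  classical
  let p : Finset (Finset ι) → Prop := fun 𝓑 => (𝓑 : Set (Finset ι)).PairwiseDisjoint id ∧
      ∀ s ∈ 𝓑, IsChainIndep b s ∧ s.Nonempty ∧
        t ≤ Nat.card (AddSubgroup.closure (b '' s)) ∧ s.card ≤ t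
  obtain ⟨𝓑, h𝓑, hmax⟩ := Finset.exists_max_image (Finset.univ.filter p) Finset.card
    ⟨∅, by simp [p]⟩
  rw [Finset.mem_filter] at h𝓑
  refine ⟨𝓑, h𝓑.2.1, h𝓑.2.2, ?_⟩
  by_contra! hcard
  obtain ⟨s, hsR, hs, hst, hts⟩ := exists_isChainIndep hcard
  have hne : s.Nonempty := by
    rw [Finset.nonempty_iff_ne_empty]
    rintro rfl
    simp at hts
    lia
  have hsdisj : ∀ u ∈ 𝓑, Disjoint s u := fun u hu => by
    refine Finset.disjoint_left.2 fun i hi hiu => ?_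
    exact Finset.mem_compl.1 (hsR hi) (Finset.mem_biUnion.2 ⟨u, hu, hiu⟩)
  have hnotMem : s ∉ 𝓑 := fun h => hne.ne_empty (disjoint_self.1 (hsdisj s h))
  have hins : p (insert s 𝓑) := by
    refine ⟨?_, fun u hu => ?_⟩
    · rw [Finset.coe_insert]
      exact h𝓑.2.1.insert fun u hu _ => hsdisj u hu
    · rcases Finset.mem_insert.1 hu with rfl | hu
      · exact ⟨hs, hne, hts, hst⟩
      · exact h𝓑.2.2 u hu
  have := hmax _ (Finset.mem_filter.2 ⟨Finset.mem_univ _, hins⟩)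
  rw [Finset.card_insert_of_notMem hnotMem] at this
  lia

theorem stmt2 (ε : ℝ) (hε0 : 0 < ε) (hε1 : ε < 1) :
    ∃ (Cε Kε : ℝ) (n₀ : ℕ), 0 < Cε ∧ 0 < Kε ∧ ∀ n : ℕ, n₀ ≤ n →
      ∀ (G : Type) [AddCommGroup G] [Fintype G], ∀ A : Fin n → G,
        Cε * Real.sqrt n ≤ (Fintype.card G : ℝ) →
        (∀ H : AddSubgroup G,
            (n : ℝ) - ε * n ≤ ({i : Fin n | A i + A i ∈ H}.ncard : ℝ) →
            Cε * Real.sqrt n ≤ (Nat.card H : ℝ)) →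
        ∀ a : G, pmProb A a ≤ Kε / Real.sqrt n := by
  refine ⟨1, 1 + 43 / √ε, ⌈(84 / ε) ^ 2⌉₊, one_pos, by positivity, ?_⟩
  intro n hn G _ _ A _ hA a
  have hsqrt : 84 / ε ≤ √n := Real.le_sqrt_of_sq_le ((Nat.le_ceil _).trans (by exact_mod_cast hn))
  have h84 : 84 ≤ ε * √n := by
    rw [div_le_iff₀ hε0] at hsqrt
    linarith
  have hsqrt84 : 84 ≤ √n := h84.trans (mul_le_of_le_one_left (Real.sqrt_nonneg _) hε1.le)
  have hsq : √n * √n = n := Real.mul_self_sqrt (Nat.cast_nonneg n)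
  have ht1 : √n ≤ (⌈√n⌉₊ : ℝ) := Nat.le_ceil _
  have ht2 : (⌈√n⌉₊ : ℝ) < √n + 1 := Nat.ceil_lt_add_one (Real.sqrt_nonneg _)
  set t := ⌈√(n : ℝ)⌉₊
  have ht : 1 < t := by
    have : (1 : ℝ) < t := by linarith
    exact_mod_cast this
  obtain ⟨𝓑, hdisj, hB, hR⟩ := exists_blocks (fun i => A i + A i) ht
  set U := 𝓑.biUnion id
  have hU : ε * n < U.card := by
    by_contra! hle
    refine not_le.2 hR (Nat.ceil_le.2 ?_)
    rw [← one_mul √(n : ℝ)]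
    refine hA _ ?_
    have hsub : ((Uᶜ : Finset (Fin n)) : Set (Fin n)) ⊆ {i : Fin n | A i + A i ∈
        AddSubgroup.closure ((fun i => A i + A i) '' ((Uᶜ : Finset (Fin n)) : Set (Fin n)))} :=
      fun i hi => AddSubgroup.subset_closure ⟨i, hi, rfl⟩
    have hcard := Set.ncard_le_ncard hsub (Set.toFinite _)
    rw [Set.ncard_coe_finset] at hcard
    have hcompl : (U.card : ℝ) + (Uᶜ).card = n := by
      exact_mod_cast (Finset.card_add_card_compl U).trans (Fintype.card_fin n)
    have hcard' : ((Uᶜ).card : ℝ) ≤ _ := Nat.cast_le.2 hcard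
    linarith
  have hUpos : (0 : ℝ) < U.card := lt_of_le_of_lt (by positivity) hU
  have h42 : 42 * t ≤ U.card := by
    have : (42 : ℝ) * t ≤ U.card := by nlinarith
    exact_mod_cast this
  have hn0 : 0 < √(n : ℝ) := by linarith
  calc pmProb A a ≤ 1 / t + 43 / √(U.card : ℝ) :=
        pmProb_le_of_blocks A a (by lia) hdisj
          (fun s hs => by
            obtain ⟨h1, h2, h3, h4⟩ := hB s hs
            exact ⟨h1, h2, h3, by lia⟩)
          rfl (by exact_mod_cast hUpos)
    _ ≤ 1 / √n + 43 / (√ε * √n) := by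
        rw [← Real.sqrt_mul hε0.le]
        have : 0 < √(ε * n) := Real.sqrt_pos.2 (mul_pos hε0 (Real.sqrt_pos.1 hn0))
        gcongr
    _ = (1 + 43 / √ε) / √n := by
        rw [add_div, div_div]
end
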